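/- If K is a local field, then every finite Galois field extension L/K is K-adequate; that is, L is a maximal subfield of some central division algebra with center K. -/

import Mathlib

noncomputable section

/-- `L` is a `K`-adequate extension: `L` embeds over `K` as a maximal subfield of a
finite-dimensional central division algebra with center `K` (a subfield of degree equal
to the index of the division algebra). -/
def IsAdequate (K L : Type) [Field K] [Field L] [Algebra K L] : Prop :=
  ∃ (D : Type) (hD : DivisionRing D),
    letI := hD
    ∃ hDA : Algebra K D,
      letI := hDA
      FiniteDimensional K D ∧ Subalgebra.center K D = ⊥ ∧
        ∃ _f : L →ₐ[K] D,
          Module.finrank K L * Module.finrank K L = Module.finrank K D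

/-- `K` is a local field: an archimedean local field (`ℝ` or `ℂ`) or a nonarchimedean
local field (a finite extension of `ℚ_p` or of `𝔽_p((t))`). -/
def IsLocalField (K : Type) [Field K] : Prop :=
  Nonempty (K ≃+* ℝ) ∨ Nonempty (K ≃+* ℂ) ∨
    (∃ (p : ℕ) (hp : p.Prime),
      letI : Fact p.Prime := ⟨hp⟩
      ∃ hA : Algebra ℚ_[p] K, letI := hA; FiniteDimensional ℚ_[p] K) ∨
    (∃ (p : ℕ) (hp : p.Prime),
      letI : Fact p.Prime := ⟨hp⟩
      ∃ hA : Algebra (LaurentSeries (ZMod p)) K,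
        letI := hA
        FiniteDimensional (LaurentSeries (ZMod p)) K)

theorem adequate_of_action {K L W V : Type} [Field K] [Field L] [Field W] [Algebra K L] [Algebra K W]
    [AddCommGroup V] [Module K V] (N : ℕ) (hN : 0 < N) [FiniteDimensional K W]
    (hW : Module.finrank K W = N) (φ : W ≃ₐ[K] W)
    (hfix : ∀ w, φ w = w → ∃ a : K, algebraMap K W a = w)
    (hφ : ∀ i, 0 < i → i < N → ∃ a, (φ ^ i) a ≠ a) (π : K) (hπ : π ≠ 0) (ρ : W →ₐ[K] Module.End K V)
    (Q : Module.End K V) (hQ : ∀ w, Q * ρ w = ρ (φ w) * Q)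
    (hQN : Q ^ N = algebraMap K (Module.End K V) π)
    (hinj : ∀ (w : Fin N → W) (g : V), (∑ i, ρ (w i) * Q ^ (i : ℕ)) g = 0 → w = 0 ∨ g = 0)
    (l : L →ₐ[K] Module.End K V) (hlρ : ∀ x w, Commute (l x) (ρ w))
    (hlQ : ∀ x, Commute (l x) Q) [FiniteDimensional K V] [Nontrivial V]
    (hn : Module.finrank K L ≤ N)
    (hV : Module.finrank K V ≤ Module.finrank K L * N) : IsAdequate K L := by
  classical
  have hQk : ∀ (k : ℕ) w, Q ^ k * ρ w = ρ ((φ ^ k) w) * Q ^ k := by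
    intro k
    induction k with
    | zero => intro w; simp
    | succ k ih =>
      intro w
      rw [pow_succ, mul_assoc, hQ, ← mul_assoc, ih, mul_assoc, pow_succ]
      rfl
  let T : (Fin N → W) →ₗ[K] Module.End K V :=
    { toFun := fun w => ∑ i, ρ (w i) * Q ^ (i : ℕ)
      map_add' := by
        intro a b
        simp [add_mul, Finset.sum_add_distrib]
      map_smul' := by
        intro a b
        simp [Finset.smul_sum] }
  have hT : ∀ w, T w = ∑ i, ρ (w i) * Q ^ (i : ℕ) := fun _ => rfl
  have hsingle : ∀ (a : W) (k : ℕ), ρ a * Q ^ k ∈ LinearMap.range T := by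
    intro a k
    refine ⟨Pi.single ⟨k % N, Nat.mod_lt _ hN⟩ ((π ^ (k / N)) • a), ?_⟩
    rw [hT, Finset.sum_eq_single ⟨k % N, Nat.mod_lt _ hN⟩]
    · have : Q ^ k = algebraMap K (Module.End K V) (π ^ (k / N)) * Q ^ (k % N) := by
        conv_lhs => rw [← Nat.div_add_mod k N, pow_add, pow_mul, hQN, ← map_pow]
      rw [this, Pi.single_eq_same, ← mul_assoc, map_smul, Algebra.smul_def, Algebra.commutes]
    · intro b _ hb
      rw [Pi.single_eq_of_ne hb]; simp
    · simp
  have hTmul : ∀ a b, T a * T b ∈ LinearMap.range T := by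
    intro a b
    rw [hT, hT, Finset.sum_mul]
    refine Submodule.sum_mem _ fun i _ => ?_
    rw [Finset.mul_sum]
    refine Submodule.sum_mem _ fun j _ => ?_
    have : ρ (a i) * Q ^ (i : ℕ) * (ρ (b j) * Q ^ (j : ℕ)) =
        ρ (a i * (φ ^ (i : ℕ)) (b j)) * Q ^ ((i : ℕ) + j) := by
      rw [map_mul, pow_add, mul_assoc, ← mul_assoc (Q ^ (i : ℕ)), hQk]
      simp only [mul_assoc]
    rw [this]
    exact hsingle _ _
  let D : Subalgebra K (Module.End K V) := (LinearMap.range T).toSubalgebra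
    (by simpa using hsingle 1 0) (by rintro _ _ ⟨a, rfl⟩ ⟨b, rfl⟩; exact hTmul a b)
  have hTinj : Function.Injective T := by
    rw [injective_iff_map_eq_zero]
    intro w hw
    obtain ⟨g, hg⟩ := exists_ne (0 : V)
    exact (hinj w g (by rw [← hT, hw]; rfl)).resolve_right hg
  have hDinj : ∀ (d : D) (g : V), (d : Module.End K V) g = 0 → d = 0 ∨ g = 0 := by
    rintro ⟨_, ⟨w, rfl⟩⟩ g hg
    rcases hinj w g hg with h | h
    · left; subst h; ext1; simp
    · exact Or.inr h
  have hDmem : ∀ x, x ∈ D ↔ ∃ w, T w = x := fun x => Iff.rfl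
  have hDfin : Module.finrank K D = N * N := by
    have : Module.finrank K D = Module.finrank K (LinearMap.range T) := rfl
    rw [this, LinearMap.finrank_range_of_inj hTinj, Module.finrank_pi_fintype]
    simp [hW]
  have : FiniteDimensional K D := inferInstance
  have : NoZeroDivisors D := by
    constructor
    intro a b hab
    by_contra! h
    obtain ⟨g, hg⟩ := exists_ne (0 : V)
    have h1 : (b : Module.End K V) g ≠ 0 := fun h0 => (hDinj b g h0).elim h.2 hg
    have h2 : (a : Module.End K V) ((b : Module.End K V) g) ≠ 0 :=
      fun h0 => (hDinj a _ h0).elim h.1 h1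
    apply h2
    have : ((a * b : D) : Module.End K V) g = 0 := by rw [hab]; rfl
    exact this
  have : IsDomain D := NoZeroDivisors.to_isDomain D
  obtain ⟨g0, hg0⟩ := exists_ne (0 : V)
  let ev : D →ₗ[K] V :=
    { toFun := fun d => (d : Module.End K V) g0
      map_add' := fun _ _ => rfl
      map_smul' := fun _ _ => rfl }
  have hev : ∀ d : D, ev d = (d : Module.End K V) g0 := fun _ => rfl
  have hevinj : Function.Injective ev := by
    rw [injective_iff_map_eq_zero]
    intro d hd
    exact (hDinj d g0 hd).resolve_right hg0
  have hle := LinearMap.finrank_le_finrank_of_injective hevinj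
  have hLN : Module.finrank K L = N := by
    rw [hDfin] at hle
    exact le_antisymm hn (Nat.le_of_mul_le_mul_right (hle.trans hV) hN)
  have hVD : Module.finrank K D = Module.finrank K V := by
    apply le_antisymm hle
    rw [hDfin]; rw [hLN] at hV; exact hV
  have hevsurj : Function.Surjective ev :=
    (LinearMap.injective_iff_surjective_of_finrank_eq_finrank hVD).1 hevinj
  have hcomm : ∀ (x : L) (d : D), Commute (l x) (d : Module.End K V) := by
    rintro x ⟨_, ⟨w, rfl⟩⟩
    refine Commute.sum_right _ _ _ fun i _ => ?_
    exact (hlρ x _).mul_right ((hlQ x).pow_right _)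
  choose F hF using fun x : L => hevsurj (l x g0)
  have hF' : ∀ x, (F x : Module.End K V) g0 = l x g0 := hF
  have huniq : ∀ d d' : D, (d : Module.End K V) g0 = (d' : Module.End K V) g0 → d = d' :=
    fun d d' h => hevinj h
  have hFmul' : ∀ x y, F (x * y) = F y * F x := by
    intro x y
    apply huniq
    rw [hF', map_mul]
    change l x (l y g0) = (F y : Module.End K V) ((F x : Module.End K V) g0)
    rw [hF' x, ← hF' y]
    exact congrArg (fun f : Module.End K V => f g0) (hcomm x (F y))
  let f : L →ₐ[K] D :=
    { toFun := F
      map_one' := by apply huniq; rw [hF']; simp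
      map_mul' := by intro x y; rw [mul_comm]; exact hFmul' y x
      map_zero' := by apply huniq; rw [hF']; simp
      map_add' := by
        intro x y; apply huniq; rw [hF', map_add]
        change l x g0 + l y g0 = (F x : Module.End K V) g0 + (F y : Module.End K V) g0
        rw [hF', hF']
      commutes' := by
        intro r; apply huniq; rw [hF']; rw [AlgHom.commutes]; rfl }
  have hPi : Q ∈ D := by rw [hDmem]; simpa using hsingle 1 1
  have hrho : ∀ a, ρ a ∈ D := fun a => by rw [hDmem]; simpa using hsingle a 0
  refine ⟨D, divisionRingOfFiniteDimensional K D, inferInstance, inferInstance, ?_, f, ?_⟩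
  · rw [eq_bot_iff]
    rintro ⟨x, ⟨w, rfl⟩⟩ hx
    have hx' : ∀ b ∈ D, b * T w = T w * b := fun b hb =>
      congrArg Subtype.val (Subalgebra.mem_center_iff.1 hx ⟨b, hb⟩)
    have h0 : ∀ i : Fin N, 0 < (i : ℕ) → w i = 0 := by
      intro i hi
      obtain ⟨a, ha⟩ := hφ i hi i.2
      have h1 := hx' (ρ a) (hrho a)
      have h2 : T (fun i => a * w i) = T (fun i => w i * (φ ^ (i : ℕ)) a) := by
        have e1 : T (fun i => a * w i) = ρ a * T w := by
          simp only [hT, map_mul, Finset.mul_sum, mul_assoc]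
        have e2 : T (fun i => w i * (φ ^ (i : ℕ)) a) = T w * ρ a := by
          simp only [hT, map_mul, Finset.sum_mul, mul_assoc, hQk]
        rw [e1, e2, h1]
      have h3 := congrFun (hTinj h2) i
      have h4 : w i * ((φ ^ (i : ℕ)) a - a) = 0 := by rw [mul_sub, ← h3]; ring
      exact (mul_eq_zero.1 h4).resolve_right (sub_ne_zero.2 ha)
    have hTw : T w = ρ (w ⟨0, hN⟩) := by
      rw [hT, Finset.sum_eq_single ⟨0, hN⟩]
      · simp
      · intro b _ hb
        rw [h0 b (Nat.pos_of_ne_zero fun h => hb (Fin.ext h))]; simp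
      · simp
    have h5 := hx' Q hPi
    rw [hTw, hQ] at h5
    have h6 : ρ (φ (w ⟨0, hN⟩) - w ⟨0, hN⟩) * Q = 0 := by rw [map_sub, sub_mul, h5, sub_self]
    have h7 : φ (w ⟨0, hN⟩) = w ⟨0, hN⟩ := by
      have hm : (⟨ρ (φ (w ⟨0, hN⟩) - w ⟨0, hN⟩), hrho _⟩ : D) * ⟨Q, hPi⟩ = 0 := Subtype.ext h6
      rcases mul_eq_zero.1 hm with h | h
      · have := (map_eq_zero ρ).1 (congrArg Subtype.val h)
        exact sub_eq_zero.1 this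
      · exfalso
        have hp : Q = 0 := congrArg Subtype.val h
        rw [hp, zero_pow hN.ne'] at hQN
        exact hπ ((map_eq_zero _).1 hQN.symm)
    obtain ⟨a, ha⟩ := hfix _ h7
    refine Algebra.mem_bot.2 ⟨a, Subtype.ext ?_⟩
    change algebraMap K (Module.End K V) a = T w
    rw [hTw, ← ha, AlgHom.commutes]
  · rw [hLN]; exact hDfin.symm

section Residue

set_option linter.unusedSectionVars false

open IsLocalRing

/-- The valuation ring of a nonarchimedean normed field. -/
abbrev OV (Ω : Type) [NormedField Ω] [IsUltrametricDist Ω] : ValuationSubring Ω :=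
  (NormedField.valuation (K := Ω)).valuationSubring

/-- The residue field of a nonarchimedean normed field. -/
abbrev kV (Ω : Type) [NormedField Ω] [IsUltrametricDist Ω] : Type := ResidueField (OV Ω)

variable {Ω : Type} [NormedField Ω] [IsUltrametricDist Ω]

theorem mem_OV {x : Ω} : x ∈ OV Ω ↔ ‖x‖ ≤ 1 := by
  rw [Valuation.mem_valuationSubring_iff, NormedField.valuation_apply, ← NNReal.coe_le_coe]
  simp

theorem norm_OV (x : OV Ω) : ‖(x : Ω)‖ ≤ 1 := mem_OV.1 x.2

theorem isUnit_OV {x : OV Ω} : IsUnit x ↔ ‖(x : Ω)‖ = 1 := by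
  constructor
  · rintro ⟨u, rfl⟩
    have h1 := norm_OV (u : OV Ω)
    have h2 := norm_OV ((u⁻¹ : (OV Ω)ˣ) : OV Ω)
    have h3 : ‖((u : OV Ω) : Ω)‖ * ‖(((u⁻¹ : (OV Ω)ˣ) : OV Ω) : Ω)‖ = 1 := by
      rw [← norm_mul, ← MulMemClass.coe_mul, Units.mul_inv]; simp
    nlinarith [norm_nonneg ((u : OV Ω) : Ω)]
  · intro h
    have hx : (x : Ω) ≠ 0 := by rw [← norm_pos_iff, h]; norm_num
    refine IsUnit.of_mul_eq_one (⟨(x : Ω)⁻¹, mem_OV.2 (by simp [h])⟩ : OV Ω) (Subtype.ext ?_)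
    simp [hx]

theorem res_eq_zero {x : OV Ω} : residue (OV Ω) x = 0 ↔ ‖(x : Ω)‖ < 1 := by
  rw [residue_eq_zero_iff, mem_maximalIdeal, mem_nonunits_iff, isUnit_OV]
  exact ⟨fun h => lt_of_le_of_ne (norm_OV x) h, fun h => h.ne⟩

theorem res_eq {x y : OV Ω} : residue (OV Ω) x = residue (OV Ω) y ↔ ‖(x : Ω) - y‖ < 1 := by
  rw [← sub_eq_zero, ← map_sub, res_eq_zero]; simp

theorem norm_one_of_root {x : Ω} {m : ℕ} (h : x ^ m = 1) (hm : m ≠ 0) : ‖x‖ = 1 :=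
  (pow_eq_one_iff_of_nonneg (norm_nonneg _) hm).1 (by rw [← norm_pow, h, norm_one])

theorem contraction {q : ℕ} (hq : ‖(q : Ω)‖ < 1) {a b : Ω} (ha : ‖a‖ ≤ 1) (hb : ‖b‖ ≤ 1)
    (h : a ≠ b) (hab : ‖a - b‖ < 1) : ‖a ^ q - b ^ q‖ < ‖a - b‖ := by
  obtain ⟨a, rfl⟩ : ∃ a' : OV Ω, (a' : Ω) = a := ⟨⟨a, mem_OV.2 ha⟩, rfl⟩
  obtain ⟨b, rfl⟩ : ∃ b' : OV Ω, (b' : Ω) = b := ⟨⟨b, mem_OV.2 hb⟩, rfl⟩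
  have hpos : 0 < ‖(a : Ω) - b‖ := norm_pos_iff.2 (sub_ne_zero.2 h)
  rw [← geom_sum₂_mul, norm_mul]
  have hq0 : ((q : ℕ) : kV Ω) = 0 := by
    have : residue (OV Ω) ((q : ℕ) : OV Ω) = 0 := by rw [res_eq_zero]; simpa using hq
    simpa using this
  have key : ‖((∑ i ∈ Finset.range q, a ^ i * b ^ (q - 1 - i) : OV Ω) : Ω)‖ < 1 := by
    rw [← res_eq_zero, map_sum]
    have hr : residue (OV Ω) a = residue (OV Ω) b := res_eq.2 hab
    have : ∀ i ∈ Finset.range q, residue (OV Ω) (a ^ i * b ^ (q - 1 - i)) =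
        residue (OV Ω) b ^ (q - 1) := by
      intro i hi
      rw [Finset.mem_range] at hi
      rw [map_mul, map_pow, map_pow, hr, ← pow_add]
      congr 1; omega
    rw [Finset.sum_congr rfl this]
    simp [hq0]
  push_cast at key
  nlinarith

theorem eq_of_fixed {q : ℕ} (hq : ‖(q : Ω)‖ < 1) {a b : Ω} (ha : ‖a‖ ≤ 1) (hb : ‖b‖ ≤ 1)
    (ha' : a ^ q = a) (hb' : b ^ q = b) (hab : ‖a - b‖ < 1) : a = b := by
  by_contra h
  have := contraction hq ha hb h hab
  rw [ha', hb'] at this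
  exact lt_irrefl _ this

variable (Ω) in
/-- The residue field of a normed subfield, inside the residue field of the big field. -/
def kS (S : Type) [NormedField S] [NormedAlgebra S Ω] : Subfield (kV Ω) where
  carrier := {z | ∃ (x : S) (y : OV Ω), algebraMap S Ω x = y ∧ residue (OV Ω) y = z}
  mul_mem' := by
    rintro _ _ ⟨x, y, h, rfl⟩ ⟨x', y', h', rfl⟩
    exact ⟨x * x', y * y', by simp [h, h'], by simp⟩
  one_mem' := ⟨1, 1, by simp, by simp⟩
  add_mem' := by
    rintro _ _ ⟨x, y, h, rfl⟩ ⟨x', y', h', rfl⟩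
    exact ⟨x + x', y + y', by simp [h, h'], by simp⟩
  zero_mem' := ⟨0, 0, by simp, by simp⟩
  neg_mem' := by
    rintro _ ⟨x, y, h, rfl⟩
    exact ⟨-x, -y, by simp [h], by simp⟩
  inv_mem' := by
    rintro _ ⟨x, y, h, rfl⟩
    by_cases hy : residue (OV Ω) y = 0
    · exact ⟨0, 0, by simp, by simp [hy]⟩
    · have hn : ‖(y : Ω)‖ = 1 := by
        rw [res_eq_zero] at hy; exact le_antisymm (norm_OV y) (not_lt.1 hy)
      have hy0 : (y : Ω) ≠ 0 := by rw [← norm_pos_iff, hn]; norm_num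
      refine ⟨x⁻¹, ⟨(y : Ω)⁻¹, mem_OV.2 (by simp [hn])⟩, by simp [h], ?_⟩
      refine (eq_inv_of_mul_eq_one_left ?_)
      rw [← map_mul, ← map_one (residue (OV Ω))]
      congr 1
      exact Subtype.ext (by simp [hy0])

theorem mem_kS {S : Type} [NormedField S] [NormedAlgebra S Ω] {z : kV Ω} :
    z ∈ kS Ω S ↔ ∃ (x : S) (y : OV Ω), algebraMap S Ω x = y ∧ residue (OV Ω) y = z := Iff.rfl

theorem finite_kS (S : Type) [NormedField S] [NormedAlgebra S Ω] [ProperSpace S] :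
    Finite (kS Ω S) := by
  let B := Metric.closedBall (0 : S) 1
  have hB : ∀ x : B, ‖algebraMap S Ω x‖ ≤ 1 := by
    intro x
    rw [norm_algebraMap']
    exact mem_closedBall_zero_iff.1 x.2
  let f : B → kV Ω := fun x => residue (OV Ω) ⟨algebraMap S Ω x, mem_OV.2 (hB x)⟩
  have hf : IsLocallyConstant f := by
    rw [IsLocallyConstant.iff_exists_open]
    intro x
    refine ⟨Metric.ball x 1, Metric.isOpen_ball, Metric.mem_ball_self one_pos, ?_⟩
    intro y hy
    rw [res_eq]
    dsimp only
    rw [← map_sub, norm_algebraMap', ← dist_eq_norm]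
    exact hy
  have : CompactSpace B := isCompact_iff_compactSpace.1 (isCompact_closedBall _ _)
  have h := hf.range_finite
  refine h.subset ?_
  rintro _ ⟨x, y, h, rfl⟩
  have hx : x ∈ B := by
    have := norm_OV y
    rw [← h, norm_algebraMap'] at this
    simpa [B] using this
  refine ⟨⟨x, hx⟩, ?_⟩
  change residue (OV Ω) _ = _
  congr 1
  exact Subtype.ext h

/-- `S` has residue field with `q` elements. -/
structure IsRes (Ω : Type) [NormedField Ω] [IsUltrametricDist Ω] (S : Type) [NormedField S]
    [NormedAlgebra S Ω] (q : ℕ) : Prop where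
  one_lt : 1 < q
  frob : ∃ F : kV Ω →+* kV Ω, ∀ z, F z = z ^ q
  norm_lt : ‖(q : Ω)‖ < 1
  mem_iff : ∀ z : kV Ω, z ∈ kS Ω S ↔ z ^ q = z

theorem isRes_card (S : Type) [NormedField S] [NormedAlgebra S Ω] [ProperSpace S] :
    IsRes Ω S (Nat.card (kS Ω S)) := by
  have := finite_kS (Ω := Ω) S
  have := Fintype.ofFinite (kS Ω S)
  have hlt : 1 < Nat.card (kS Ω S) := Finite.one_lt_card
  have hcast : ((Nat.card (kS Ω S) : ℕ) : kV Ω) = 0 := by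
    have := congrArg (Subfield.subtype (kS Ω S)) (Nat.cast_card_eq_zero (kS Ω S))
    rw [map_natCast, map_zero] at this
    rw [Nat.card_eq_fintype_card]
    exact this
  refine ⟨hlt, ?_, ?_, ?_⟩
  · obtain ⟨p, hp⟩ := CharP.exists (kS Ω S)
    obtain ⟨n, hpp, hc⟩ := FiniteField.card (kS Ω S) p
    have : Fact p.Prime := ⟨hpp⟩
    have : CharP (kV Ω) p := (RingHom.charP_iff (Subfield.subtype (kS Ω S)) 
      (Subfield.subtype (kS Ω S)).injective p).1 hp
    refine ⟨iterateFrobenius (kV Ω) p n, fun z => ?_⟩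
    rw [iterateFrobenius_def, Nat.card_eq_fintype_card, hc]
  · have : residue (OV Ω) ((Nat.card (kS Ω S) : ℕ) : OV Ω) = 0 := by simpa using hcast
    rw [res_eq_zero] at this
    simpa using this
  · intro z
    constructor
    · intro hz
      have := FiniteField.pow_card (⟨z, hz⟩ : kS Ω S)
      rw [← Nat.card_eq_fintype_card] at this
      exact congrArg Subtype.val this
    · intro hz
      classical
      set q := Nat.card (kS Ω S) with hq
      have hne := FiniteField.X_pow_card_sub_X_ne_zero (kV Ω) hlt
      have hdeg := FiniteField.X_pow_card_sub_X_natDegree_eq (kV Ω) hlt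
      by_contra hz'
      let s : Finset (kV Ω) := insert z (Finset.univ.image (Subfield.subtype (kS Ω S)))
      have hs : s.card = q + 1 := by
        rw [Finset.card_insert_of_notMem, Finset.card_image_of_injective _
          (Subfield.subtype (kS Ω S)).injective, Finset.card_univ, hq, Nat.card_eq_fintype_card]
        intro h
        obtain ⟨y, -, rfl⟩ := Finset.mem_image.1 h
        exact hz' y.2
      have hsub : s.val ≤ (Polynomial.X ^ q - Polynomial.X : Polynomial (kV Ω)).roots := by
        rw [Finset.val_le_iff_val_subset]
        intro y hy
        rw [Polynomial.mem_roots hne]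
        have : y ^ q = y := by
          rcases Finset.mem_insert.1 (Finset.mem_def.2 hy) with rfl | h
          · exact hz
          · obtain ⟨y, -, rfl⟩ := Finset.mem_image.1 h
            have := FiniteField.pow_card y
            rw [← Nat.card_eq_fintype_card] at this
            exact congrArg Subtype.val this
        simp [this]
      have h1 := Multiset.card_le_card hsub
      have h2 := Polynomial.card_roots' (Polynomial.X ^ q - Polynomial.X : Polynomial (kV Ω))
      rw [hdeg] at h2
      have h3 : Multiset.card s.val = q + 1 := hs
      omega

theorem card_kS_tower (K L : Type) [NormedField K] [NormedAlgebra K Ω] [NormedField L]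
    [NormedAlgebra L Ω] [Algebra K L] [IsScalarTower K L Ω] [ProperSpace L] :
    ∃ f : ℕ, 0 < f ∧ Nat.card (kS Ω L) = Nat.card (kS Ω K) ^ f := by
  have hle : kS Ω K ≤ kS Ω L := by
    rintro _ ⟨x, y, h, rfl⟩
    exact ⟨algebraMap K L x, y, by rw [← h, ← IsScalarTower.algebraMap_apply], rfl⟩
  have := finite_kS (Ω := Ω) L
  let : Algebra (kS Ω K) (kS Ω L) := (Subfield.inclusion hle).toAlgebra
  exact ⟨Module.finrank (kS Ω K) (kS Ω L), Module.finrank_pos, Module.natCard_eq_pow_finrank⟩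

theorem teichmuller {S : Type} [NormedField S] [NormedAlgebra S Ω] [ProperSpace S] {q : ℕ}
    (h : IsRes Ω S q) {z : kV Ω} (hz : z ∈ kS Ω S) :
    ∃ (x : S) (y : OV Ω), algebraMap S Ω x = y ∧ residue (OV Ω) y = z ∧ x ^ q = x := by
  obtain ⟨x0, y0, h0, rfl⟩ := hz
  have hx0 : ‖x0‖ ≤ 1 := by rw [← norm_algebraMap' Ω, h0]; exact norm_OV y0
  have hu : IsUltrametricDist S := by
    refine IsUltrametricDist.isUltrametricDist_of_isNonarchimedean_norm fun a b => ?_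
    rw [← norm_algebraMap' Ω (a + b), ← norm_algebraMap' Ω a, ← norm_algebraMap' Ω b, map_add]
    exact IsUltrametricDist.norm_add_le_max _ _
  have hc : IsCompact (Metric.ball x0 1) :=
    Metric.isCompact_of_isClosed_isBounded (IsUltrametricDist.isClosed_ball _ _) Metric.isBounded_ball
  obtain ⟨x, hx, hmin⟩ := hc.exists_isMinOn ⟨x0, Metric.mem_ball_self one_pos⟩
    (f := fun x : S => ‖x ^ q - x‖) (by fun_prop)
  have hxx0 : ‖x - x0‖ < 1 := by simpa [dist_eq_norm] using hx
  have hx1 : ‖x‖ ≤ 1 := by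
    have := IsUltrametricDist.norm_add_le_max (x - x0) x0
    rw [sub_add_cancel] at this
    exact this.trans (max_le hxx0.le hx0)
  let y : OV Ω := ⟨algebraMap S Ω x, mem_OV.2 (by rwa [norm_algebraMap'])⟩
  have hy : residue (OV Ω) y = residue (OV Ω) y0 := by
    rw [res_eq]
    change ‖algebraMap S Ω x - _‖ < 1
    rwa [← h0, ← map_sub, norm_algebraMap']
  refine ⟨x, y, rfl, hy, ?_⟩
  by_contra hne
  have hres : residue (OV Ω) (y ^ q) = residue (OV Ω) y := by
    rw [map_pow]
    exact (h.mem_iff _).1 ⟨x, y, rfl, rfl⟩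
  have hlt : ‖x ^ q - x‖ < 1 := by
    rw [res_eq] at hres
    change ‖(algebraMap S Ω x) ^ q - algebraMap S Ω x‖ < 1 at hres
    rwa [← map_pow, ← map_sub, norm_algebraMap'] at hres
  have hxq : x ^ q ∈ Metric.ball x0 1 := by
    rw [mem_ball_iff_norm]
    have := IsUltrametricDist.norm_add_le_max (x ^ q - x) (x - x0)
    rw [sub_add_sub_cancel] at this
    exact this.trans_lt (max_lt hlt hxx0)
  have h1 := hmin hxq
  have h1' : ‖x ^ q - x‖ ≤ ‖(x ^ q) ^ q - x ^ q‖ := h1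
  have h2 := contraction h.norm_lt (a := algebraMap S Ω (x ^ q)) (b := algebraMap S Ω x)
    (by rw [norm_algebraMap', norm_pow]; exact pow_le_one₀ (norm_nonneg _) hx1)
    (by rwa [norm_algebraMap']) (fun he => hne ((algebraMap S Ω).injective he))
    (by rwa [← map_sub, norm_algebraMap'])
  rw [← map_pow, ← map_pow, ← map_sub, ← map_sub, norm_algebraMap', norm_algebraMap'] at h2
  linarith

theorem res_primitive {q : ℕ} (hq1 : 1 < q) (hq : ‖(q : Ω)‖ < 1) {η : OV Ω}
    (hη : IsPrimitiveRoot (η : Ω) (q - 1)) : IsPrimitiveRoot (residue (OV Ω) η) (q - 1) := by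
  have hη1 : η ^ (q - 1) = 1 := Subtype.ext (by simpa using hη.pow_eq_one)
  refine ⟨by rw [← map_pow, hη1, map_one], fun l hl => hη.dvd_of_pow_eq_one l ?_⟩
  rw [← map_pow, ← map_one (residue (OV Ω)), res_eq] at hl
  refine eq_of_fixed hq (b := (1 : Ω)) (a := (η : Ω) ^ l) ?_ (by simp) ?_ (by simp) (by simpa using hl)
  · rw [norm_pow]; exact pow_le_one₀ (norm_nonneg _) (norm_OV η)
  · have : (η : Ω) ^ q = η := by
      conv_lhs => rw [show q = (q - 1) + 1 by omega, pow_succ, hη.pow_eq_one, one_mul]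
    rw [← pow_mul, mul_comm, pow_mul, this]

theorem approx_unit {S : Type} [NormedField S] [NormedAlgebra S Ω] {q : ℕ}
    (h : IsRes Ω S q) {η : Ω} (hη : IsPrimitiveRoot η (q - 1)) {u : S} (hu : ‖u‖ = 1) :
    ∃ i : ℕ, ‖algebraMap S Ω u - η ^ i‖ < 1 := by
  have hq0 : q - 1 ≠ 0 := by have := h.one_lt; omega
  have hη1 : ‖η‖ = 1 := norm_one_of_root hη.pow_eq_one hq0
  obtain ⟨η, rfl⟩ : ∃ a' : OV Ω, (a' : Ω) = η := ⟨⟨η, mem_OV.2 hη1.le⟩, rfl⟩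
  have hp := res_primitive h.one_lt h.norm_lt hη
  let y : OV Ω := ⟨algebraMap S Ω u, mem_OV.2 (by rw [norm_algebraMap', hu])⟩
  have hy0 : residue (OV Ω) y ≠ 0 := by
    rw [Ne, res_eq_zero]
    change ¬ ‖algebraMap S Ω u‖ < 1
    rw [norm_algebraMap', hu]; norm_num
  have hyq : residue (OV Ω) y ^ q = residue (OV Ω) y := (h.mem_iff _).1 ⟨u, y, rfl, rfl⟩
  have hy1 : residue (OV Ω) y ^ (q - 1) = 1 := by
    apply mul_right_cancel₀ hy0
    rw [one_mul, ← pow_succ]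
    conv_lhs => rw [show (q - 1) + 1 = q by omega]
    exact hyq
  have : NeZero (q - 1) := ⟨hq0⟩
  obtain ⟨i, -, hi⟩ := hp.eq_pow_of_pow_eq_one hy1
  refine ⟨i, ?_⟩
  rw [← map_pow, eq_comm, res_eq] at hi
  simpa using hi

theorem exists_primitive {S : Type} [NormedField S] [NormedAlgebra S Ω] [ProperSpace S] :
    ∃ η : S, IsPrimitiveRoot (algebraMap S Ω η) (Nat.card (kS Ω S) - 1) := by
  have := finite_kS (Ω := Ω) S
  have h := isRes_card (Ω := Ω) S
  set q := Nat.card (kS Ω S) with hq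
  obtain ⟨g, hg⟩ := IsCyclic.exists_generator (α := (kS Ω S)ˣ)
  have hord : orderOf g = q - 1 := by
    rw [orderOf_eq_card_of_forall_mem_zpowers hg, Nat.card_units]
  obtain ⟨x, y, hxy, hyz, hxq⟩ := teichmuller h (z := ((g : kS Ω S) : kV Ω)) (g : kS Ω S).2
  have hx0 : x ≠ 0 := by
    rintro rfl
    rw [map_zero] at hxy
    have : y = 0 := Subtype.ext (by simpa using hxy.symm)
    rw [this, map_zero] at hyz
    exact g.ne_zero (Subtype.ext hyz.symm)
  refine ⟨x, ?_, ?_⟩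
  · rw [← map_pow]
    have : x ^ (q - 1) = 1 := by
      apply mul_right_cancel₀ hx0
      rw [one_mul, ← pow_succ]
      have := h.one_lt
      conv_lhs => rw [show (q - 1) + 1 = q by omega]
      exact hxq
    rw [this, map_one]
  · intro l hl
    rw [← hord]
    apply orderOf_dvd_of_pow_eq_one
    have hy : y ^ l = 1 := Subtype.ext (by simpa [hxy] using hl)
    have := congrArg (residue (OV Ω)) hy
    rw [map_pow, hyz, map_one] at this
    exact Units.ext (Subtype.ext (by simpa using this))

end Residue

section Unramified

set_option linter.unusedSectionVars false

open IsLocalRing Polynomial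

theorem pow_sub_one_gt {q n j : ℕ} (hq : 1 < q) (hn : 1 < n) (hj : j < n) : q ^ j < q ^ n - 1 := by
  have h1 : q ^ j ≤ q ^ (n - 1) := Nat.pow_le_pow_right (by omega) (by omega)
  have h2 : q ^ n = q ^ (n - 1) * q := by rw [← pow_succ]; congr 1; omega
  have h3 : 2 ≤ q ^ (n - 1) := by
    calc 2 ≤ q := hq
      _ = q ^ 1 := (pow_one q).symm
      _ ≤ q ^ (n - 1) := Nat.pow_le_pow_right (by omega) (by omega)
  have h4 : q ^ (n - 1) * 2 ≤ q ^ (n - 1) * q := Nat.mul_le_mul_left _ hq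
  omega

theorem natDeg_lt_iff {R : Type} [Semiring R] {p : R[X]} {n : ℕ} (hn : 0 < n) :
    p.natDegree < n ↔ p.degree < n := by
  by_cases hp : p = 0
  · simp [hp, hn, WithBot.bot_lt_coe]
  · exact natDegree_lt_iff_degree_lt hp

theorem conjq_injective {F : Type} [Field F] {z : F} {q n : ℕ} (hq : 1 < q)
    (hz : IsPrimitiveRoot z (q ^ n - 1)) : Function.Injective fun i : Fin n => z ^ (q ^ (i : ℕ)) := by
  intro i j hij
  rcases Nat.lt_or_ge 1 n with hn | hn
  · have := hz.pow_inj (pow_sub_one_gt hq hn i.2) (pow_sub_one_gt hq hn j.2) hij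
    exact Fin.ext (Nat.pow_right_injective hq this)
  · have := i.2
    have := j.2
    exact Fin.ext (by omega)

theorem pow_q_n {F : Type} [Field F] {z : F} {q n : ℕ} (hq : 1 < q)
    (hz : IsPrimitiveRoot z (q ^ n - 1)) : z ^ (q ^ n) = z := by
  have : 0 < q ^ n := Nat.pow_pos (by omega)
  conv_lhs => rw [show q ^ n = (q ^ n - 1) + 1 by omega, pow_succ, hz.pow_eq_one, one_mul]

variable {Ω : Type} [NormedField Ω] [IsUltrametricDist Ω]
  {S : Type} [NormedField S] [NormedAlgebra S Ω]

theorem norm_q_pow {q n : ℕ} (h : IsRes Ω S q) (hn : 0 < n) : ‖((q ^ n : ℕ) : Ω)‖ < 1 := by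
  rw [Nat.cast_pow, norm_pow]
  exact pow_lt_one₀ (norm_nonneg _) h.norm_lt hn.ne'

theorem norm_zeta {q n : ℕ} (h : IsRes Ω S q) (hn : 0 < n) {ζ : Ω}
    (hζ : IsPrimitiveRoot ζ (q ^ n - 1)) : ‖ζ‖ = 1 :=
  norm_one_of_root hζ.pow_eq_one (by have := Nat.one_lt_pow hn.ne' h.one_lt; omega)

theorem res_eval {q n : ℕ} (h : IsRes Ω S q) (hn : 0 < n) (ζ : OV Ω)
    (hζ : IsPrimitiveRoot (ζ : Ω) (q ^ n - 1)) (B : S[X]) (hB : ∀ i, ‖B.coeff i‖ ≤ 1)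
    (hdeg : B.degree < n) (hlt : ‖aeval (ζ : Ω) B‖ < 1) : ∀ i, ‖B.coeff i‖ < 1 := by
  let y : ℕ → OV Ω := fun i => ⟨algebraMap S Ω (B.coeff i), mem_OV.2 (by
    rw [norm_algebraMap']; exact hB i)⟩
  have hy : ∀ i, (y i : Ω) = algebraMap S Ω (B.coeff i) := fun _ => rfl
  let C' : (kV Ω)[X] := ∑ i ∈ Finset.range n, C (residue (OV Ω) (y i)) * X ^ i
  obtain ⟨F, hF⟩ := h.frob
  have hyF : ∀ i, residue (OV Ω) (y i) ^ q = residue (OV Ω) (y i) := fun i =>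
    (h.mem_iff _).1 ⟨B.coeff i, y i, rfl, rfl⟩
  have hev : ∀ z, C'.eval z = ∑ i ∈ Finset.range n, residue (OV Ω) (y i) * z ^ i := by
    intro z; simp [C', eval_finsetSum]
  have hev0 : C'.eval (residue (OV Ω) ζ) = 0 := by
    rw [hev]
    have : residue (OV Ω) (∑ i ∈ Finset.range n, y i * ζ ^ i) = 0 := by
      rw [res_eq_zero]
      push_cast
      rw [aeval_eq_sum_range' (n := n)] at hlt
      · simpa [Algebra.smul_def, hy] using hlt
      · exact (natDeg_lt_iff hn).2 hdeg
    simpa using this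
  have hevq : ∀ z, C'.eval (z ^ q) = (C'.eval z) ^ q := by
    intro z
    rw [← hF (C'.eval z), hev, hev, map_sum]
    refine Finset.sum_congr rfl fun i _ => ?_
    rw [map_mul, hF, hF, hyF, ← pow_mul, ← pow_mul, mul_comm q]
  have hroots : ∀ j : ℕ, C'.eval (residue (OV Ω) ζ ^ (q ^ j)) = 0 := by
    intro j
    induction j with
    | zero => simpa using hev0
    | succ j ih =>
      have := h.one_lt
      rw [pow_succ, pow_mul, hevq, ih, zero_pow (by omega)]
  have hprim := res_primitive (Nat.one_lt_pow hn.ne' h.one_lt) (norm_q_pow h hn) hζ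
  have hC0 : C' = 0 := by
    refine eq_zero_of_natDegree_lt_card_of_eval_eq_zero C' (conjq_injective h.one_lt hprim)
      (fun i => hroots i) ?_
    rw [Fintype.card_fin, natDeg_lt_iff hn]
    refine (degree_sum_le _ _).trans_lt ?_
    rw [Finset.sup_lt_iff (by simpa using WithBot.bot_lt_coe n)]
    intro i hi
    refine (degree_C_mul_X_pow_le _ _).trans_lt ?_
    exact_mod_cast Finset.mem_range.1 hi
  intro i
  by_cases hi : i < n
  · have : C'.coeff i = residue (OV Ω) (y i) := by
      simp only [C', finsetSum_coeff, coeff_C_mul_X_pow]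
      simp [hi]
    rw [hC0, coeff_zero, eq_comm, res_eq_zero, hy, norm_algebraMap'] at this
    exact this
  · rw [coeff_eq_zero_of_degree_lt (hdeg.trans_le (by exact_mod_cast not_lt.1 hi))]
    simp

theorem coeff_le {q n : ℕ} (h : IsRes Ω S q) (hn : 0 < n) {ζ : Ω}
    (hζ : IsPrimitiveRoot ζ (q ^ n - 1)) (A : S[X]) (hdeg : A.degree < n) (i : ℕ) :
    ‖A.coeff i‖ ≤ ‖aeval ζ A‖ := by
  by_cases hA : A = 0
  · simp [hA]
  obtain ⟨i0, hi0, hmax⟩ := Finset.exists_max_image A.support (fun i => ‖A.coeff i‖)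
    (Finset.nonempty_of_ne_empty (by simpa using hA))
  have hmax' : ∀ i, ‖A.coeff i‖ ≤ ‖A.coeff i0‖ := by
    intro i
    by_cases hi : i ∈ A.support
    · exact hmax i hi
    · rw [notMem_support_iff.1 hi]; simp
  refine (hmax' i).trans ?_
  have ha0 : A.coeff i0 ≠ 0 := mem_support_iff.1 hi0
  have ha0' : 0 < ‖A.coeff i0‖ := norm_pos_iff.2 ha0
  by_contra! hlt
  have hz1 := norm_zeta h hn hζ
  have := res_eval h hn ⟨ζ, mem_OV.2 hz1.le⟩ hζ (C (A.coeff i0)⁻¹ * A)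
    (fun i => by
      rw [coeff_C_mul, norm_mul, norm_inv, inv_mul_le_one₀ ha0']; exact hmax' i)
    (by rwa [degree_C_mul (inv_ne_zero ha0)])
    (by
      rw [map_mul, aeval_C, norm_mul, norm_algebraMap', norm_inv, inv_mul_lt_one₀ ha0']
      exact hlt) i0
  rw [coeff_C_mul, inv_mul_cancel₀ ha0, norm_one] at this
  exact lt_irrefl _ this

theorem conj_of_aut {q n : ℕ} (h : IsRes Ω S q) (hn : 0 < n) {ζ : Ω}
    (hζ : IsPrimitiveRoot ζ (q ^ n - 1)) (τ : Ω ≃ₐ[S] Ω) (hτ : ∀ x, ‖τ x‖ = ‖x‖) :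
    ∃ i : Fin n, τ ζ = ζ ^ (q ^ (i : ℕ)) := by
  have hz1 := norm_zeta h hn hζ
  let z : OV Ω := ⟨ζ, mem_OV.2 hz1.le⟩
  let z' : OV Ω := ⟨τ ζ, mem_OV.2 (by rw [hτ, hz1])⟩
  obtain ⟨F, hF⟩ := h.frob
  let g : ℕ → (kV Ω)[X] := fun i => X - C (residue (OV Ω) z ^ (q ^ i))
  let P : (kV Ω)[X] := ∏ i ∈ Finset.range n, g i
  have hprim : IsPrimitiveRoot (residue (OV Ω) z) (q ^ n - 1) :=
    res_primitive (Nat.one_lt_pow hn.ne' h.one_lt) (norm_q_pow h hn) hζ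
  have hgF : ∀ i, (g i).map F = g (i + 1) := by
    intro i
    simp only [g, Polynomial.map_sub, map_X, map_C, hF, ← pow_mul, ← pow_succ]
  have hgn : g n = g 0 := by
    simp only [g, pow_q_n h.one_lt hprim, pow_zero, pow_one]
  have hPF : P.map F = P := by
    simp only [P, Polynomial.map_prod, hgF]
    have h1 := Finset.prod_range_succ g n
    rw [Finset.prod_range_succ', hgn] at h1
    exact mul_right_cancel₀ (X_sub_C_ne_zero _) h1
  have hcoef : ∀ i, P.coeff i ∈ kS Ω S := by
    intro i
    rw [h.mem_iff, ← hF, ← coeff_map, hPF]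
  choose a y hay hyr using hcoef
  let d := P.natDegree + 1
  have hPev : ∀ w : OV Ω, residue (OV Ω) (∑ i ∈ Finset.range d, y i * w ^ i) =
      P.eval (residue (OV Ω) w) := by
    intro w
    rw [eval_eq_sum_range, map_sum]
    exact Finset.sum_congr rfl fun i _ => by rw [map_mul, map_pow, hyr]
  have hP0 : P.eval (residue (OV Ω) z) = 0 := by
    rw [eval_prod]
    exact Finset.prod_eq_zero (Finset.mem_range.2 hn) (by simp [g])
  rw [← hPev, res_eq_zero, ← hτ] at hP0
  have hP1 : P.eval (residue (OV Ω) z') = 0 := by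
    rw [← hPev, res_eq_zero]
    convert hP0 using 2
    push_cast
    rw [map_sum]
    refine Finset.sum_congr rfl fun i _ => ?_
    rw [map_mul, map_pow, ← hay, AlgEquiv.commutes]
  rw [eval_prod, Finset.prod_eq_zero_iff] at hP1
  obtain ⟨i, hi, hi0⟩ := hP1
  refine ⟨⟨i, Finset.mem_range.1 hi⟩, ?_⟩
  simp only [g, eval_sub, eval_X, eval_C, sub_eq_zero] at hi0
  rw [← map_pow, res_eq] at hi0
  have hzz := pow_q_n h.one_lt hζ
  refine eq_of_fixed (norm_q_pow h hn) (by rw [hτ, hz1]) (by rw [norm_pow, hz1, one_pow])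
    (by rw [← map_pow, hzz]) (by rw [← pow_mul, mul_comm, pow_mul, hzz]) ?_
  simpa using hi0

variable [IsAlgClosed Ω] [Algebra.IsAlgebraic S Ω]

open IntermediateField in
theorem unramified {q n : ℕ} (h : IsRes Ω S q) (hn : 0 < n) {ζ : Ω}
    (hζ : IsPrimitiveRoot ζ (q ^ n - 1)) (hiso : ∀ (τ : Ω ≃ₐ[S] Ω) x, ‖τ x‖ = ‖x‖) :
    (minpoly S ζ).natDegree = n ∧ ∃ σ : Ω ≃ₐ[S] Ω, σ ζ = ζ ^ q := by
  classical
  have : IsAlgClosure S Ω := ⟨inferInstance, inferInstance⟩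
  have : Normal S Ω := IsAlgClosure.normal S Ω
  have : Nonempty (Fin n) := ⟨⟨0, hn⟩⟩
  have hIsInt : IsIntegral S ζ := Algebra.IsIntegral.isIntegral ζ
  have hge : n ≤ (minpoly S ζ).natDegree := by
    by_contra! hlt
    have := coeff_le h hn hζ (minpoly S ζ) ((natDeg_lt_iff hn).1 hlt)
      (minpoly S ζ).natDegree
    rw [minpoly.aeval, coeff_natDegree, minpoly.monic hIsInt] at this
    norm_num at this
  have hN : ((q ^ n - 1 : ℕ) : S) ≠ 0 := by
    intro h0
    have h1 : ((q ^ n - 1 : ℕ) : Ω) = 0 := by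
      rw [← map_natCast (algebraMap S Ω), h0, map_zero]
    have h2 := norm_q_pow h hn
    have h3 : q ^ n = (q ^ n - 1) + 1 := by
      have : 0 < q ^ n := Nat.pow_pos (by have := h.one_lt; omega)
      omega
    rw [h3, Nat.cast_add, h1] at h2
    norm_num at h2
  have hsep : (minpoly S ζ).Separable := by
    refine Separable.of_dvd (X_pow_sub_one_separable_iff.2 hN) (minpoly.dvd S ζ ?_)
    simp [hζ.pow_eq_one]
  have hcard : Fintype.card ((minpoly S ζ).rootSet Ω) = (minpoly S ζ).natDegree :=
    card_rootSet_eq_natDegree hsep (IsAlgClosed.splits _)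
  have hroots : ∀ x ∈ (minpoly S ζ).rootSet Ω, ∃ i : Fin n, x = ζ ^ (q ^ (i : ℕ)) := by
    intro x hx
    have hx0 : aeval x (minpoly S ζ) = 0 := (mem_rootSet.1 hx).2
    obtain ⟨τ, hτ⟩ := minpoly.exists_algEquiv_of_root (Algebra.IsAlgebraic.isAlgebraic (R := S) ζ) hx0
    obtain ⟨i, hi⟩ := conj_of_aut h hn hζ τ.symm (hiso τ.symm)
    have hτ' : τ.symm ζ = x := by rw [AlgEquiv.symm_apply_eq]; exact hτ.symm
    exact ⟨i, by rw [← hi, hτ']⟩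
  choose! r hr using hroots
  have hrinj : Function.Injective fun x : (minpoly S ζ).rootSet Ω => r x := by
    intro x y hxy
    apply Subtype.ext
    have hxy' : r (x : Ω) = r y := hxy
    rw [hr x x.2, hr y y.2, hxy']
  have hle := Fintype.card_le_of_injective _ hrinj
  rw [hcard, Fintype.card_fin] at hle
  have heq : (minpoly S ζ).natDegree = n := le_antisymm hle hge
  refine ⟨heq, ?_⟩
  rcases Nat.lt_or_ge 1 n with hn1 | hn1
  · have hbij := (Fintype.bijective_iff_injective_and_card _).2
      ⟨hrinj, by rw [hcard, Fintype.card_fin, heq]⟩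
    obtain ⟨x, hx⟩ := hbij.2 ⟨1, hn1⟩
    have hx' : r (x : Ω) = ⟨1, hn1⟩ := hx
    have hx0 : aeval (x : Ω) (minpoly S ζ) = 0 := (mem_rootSet.1 x.2).2
    obtain ⟨τ, hτ⟩ := minpoly.exists_algEquiv_of_root (Algebra.IsAlgebraic.isAlgebraic (R := S) ζ) hx0
    have hτ' : τ.symm ζ = (x : Ω) := by rw [AlgEquiv.symm_apply_eq]; exact hτ.symm
    have hxq := hr x x.2
    rw [hx', pow_one] at hxq
    exact ⟨τ.symm, hτ'.trans hxq⟩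
  · obtain rfl : n = 1 := by omega
    have := pow_q_n h.one_lt hζ
    rw [pow_one] at this
    exact ⟨AlgEquiv.refl, by rw [this]; rfl⟩

theorem iter_zeta {σ : Ω ≃ₐ[S] Ω} {q : ℕ} {ζ : Ω} (hσ : σ ζ = ζ ^ q) (j : ℕ) :
    (σ ^ j) ζ = ζ ^ (q ^ j) := by
  induction j with
  | zero => simp
  | succ j ih => rw [pow_succ, AlgEquiv.mul_apply, hσ, map_pow, ih, ← pow_mul, pow_succ]

open IntermediateField in
theorem exists_poly {n : ℕ} {ζ : Ω} (hdeg : (minpoly S ζ).natDegree = n) {x : Ω}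
    (hx : x ∈ S⟮ζ⟯) : ∃ A : S[X], A.degree < n ∧ aeval ζ A = x := by
  have hIsInt : IsIntegral S ζ := Algebra.IsIntegral.isIntegral ζ
  have hx' : x ∈ (S⟮ζ⟯).toSubalgebra := hx
  rw [adjoin_simple_toSubalgebra_of_isAlgebraic hIsInt.isAlgebraic,
    Algebra.adjoin_singleton_eq_range_aeval] at hx'
  obtain ⟨A, hA⟩ := hx'
  refine ⟨A %ₘ minpoly S ζ, ?_, ?_⟩
  · rw [← hdeg, ← degree_eq_natDegree (minpoly.ne_zero hIsInt)]
    exact degree_modByMonic_lt _ (minpoly.monic hIsInt)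
  · rw [aeval_modByMonic_eq_self_of_root (minpoly.aeval S ζ)]
    exact hA

theorem aut_mem {ζ : Ω} {σ : Ω ≃ₐ[S] Ω} {q : ℕ} (hσ : σ ζ = ζ ^ q) {x : Ω}
    (hx : x ∈ IntermediateField.adjoin S {ζ}) : σ x ∈ IntermediateField.adjoin S {ζ} := by
  obtain ⟨A, -, rfl⟩ := exists_poly rfl hx
  have h1 : σ (aeval ζ A) = aeval (σ ζ) A := (aeval_algHom_apply σ ζ A).symm
  rw [h1, hσ]
  rw [aeval_eq_sum_range]
  exact sum_mem fun i _ => IntermediateField.smul_mem _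
    (pow_mem (pow_mem (IntermediateField.mem_adjoin_simple_self S ζ) _) _)

theorem iter_aeval {σ : Ω ≃ₐ[S] Ω} {q : ℕ} {ζ : Ω} (hσ : σ ζ = ζ ^ q) (j : ℕ) (A : S[X]) :
    (σ ^ j) (aeval ζ A) = aeval (ζ ^ (q ^ j)) A := by
  rw [← iter_zeta hσ j]
  exact (aeval_algHom_apply (σ ^ j) ζ A).symm

theorem fixed_mem {q n : ℕ} (h : IsRes Ω S q) (hn : 0 < n) {ζ : Ω}
    (hζ : IsPrimitiveRoot ζ (q ^ n - 1)) (hdeg : (minpoly S ζ).natDegree = n)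
    {σ : Ω ≃ₐ[S] Ω} (hσ : σ ζ = ζ ^ q) {x : Ω}
    (hx : x ∈ IntermediateField.adjoin S {ζ}) (hfix : σ x = x) : ∃ a : S, algebraMap S Ω a = x := by
  obtain ⟨A, hA, rfl⟩ := exists_poly hdeg hx
  have hall : ∀ j : ℕ, (σ ^ j) (aeval ζ A) = aeval ζ A := by
    intro j
    induction j with
    | zero => simp
    | succ j ih => rw [pow_succ, AlgEquiv.mul_apply, hfix, ih]
  set x := aeval ζ A with hxdef
  have hz : A.map (algebraMap S Ω) - C x = 0 := by
    refine eq_zero_of_natDegree_lt_card_of_eval_eq_zero _ (conjq_injective h.one_lt hζ)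
      (fun i => ?_) ?_
    · rw [eval_sub, eval_C, eval_map_algebraMap, ← iter_aeval hσ, hall, sub_self]
    · rw [Fintype.card_fin]
      refine (natDegree_sub_C.le).trans_lt ?_
      exact natDegree_map_le.trans_lt ((natDeg_lt_iff hn).2 hA)
  refine ⟨A.coeff 0, ?_⟩
  have := congrArg (fun p => Polynomial.coeff p 0) hz
  simp only [coeff_sub, coeff_map, coeff_C_zero, coeff_zero, sub_eq_zero] at this
  exact this

theorem norm_value {q n : ℕ} (h : IsRes Ω S q) (hn : 0 < n) {ζ : Ω}
    (hζ : IsPrimitiveRoot ζ (q ^ n - 1)) (hdeg : (minpoly S ζ).natDegree = n) {x : Ω}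
    (hx : x ∈ IntermediateField.adjoin S {ζ}) : ∃ a : S, ‖a‖ = ‖x‖ := by
  obtain ⟨A, hA, rfl⟩ := exists_poly hdeg hx
  by_contra! hne
  have hlt : ∀ i, ‖A.coeff i‖ < ‖aeval ζ A‖ := fun i =>
    lt_of_le_of_ne (coeff_le h hn hζ A hA i) (hne _)
  have hz1 := norm_zeta h hn hζ
  have hpos : 0 < ‖aeval ζ A‖ := (norm_nonneg _).trans_lt (hlt 0)
  have : ‖aeval ζ A‖ < ‖aeval ζ A‖ := by
    conv_lhs => rw [aeval_eq_sum_range]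
    obtain ⟨i, -, hi⟩ := IsUltrametricDist.exists_norm_finsetSum_le_of_nonempty
      (Finset.nonempty_range_add_one (n := A.natDegree)) (fun i => A.coeff i • ζ ^ i)
    refine hi.trans_lt ?_
    rw [norm_smul, norm_pow, hz1, one_pow, mul_one]
    exact hlt i
  exact lt_irrefl _ this

theorem trace_unit {q n : ℕ} (h : IsRes Ω S q) (hn : 0 < n) {ζ : Ω}
    (hζ : IsPrimitiveRoot ζ (q ^ n - 1)) {σ : Ω ≃ₐ[S] Ω} (hσ : σ ζ = ζ ^ q) :
    ∃ j : ℕ, ‖∑ i ∈ Finset.range n, (σ ^ i) (ζ ^ j)‖ = 1 := by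
  have hz1 := norm_zeta h hn hζ
  rcases Nat.lt_or_ge 1 n with hn1 | hn1
  swap
  · obtain rfl : n = 1 := by omega
    exact ⟨0, by simp⟩
  by_contra! hne
  let z : OV Ω := ⟨ζ, mem_OV.2 hz1.le⟩
  have hprim : IsPrimitiveRoot (residue (OV Ω) z) (q ^ n - 1) :=
    res_primitive (Nat.one_lt_pow hn.ne' h.one_lt) (norm_q_pow h hn) hζ
  let P : (kV Ω)[X] := ∑ i ∈ Finset.range n, X ^ (q ^ i)
  have hev : ∀ j : ℕ, P.eval (residue (OV Ω) z ^ j) = 0 := by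
    intro j
    have h1 : ((∑ i ∈ Finset.range n, (z ^ j) ^ (q ^ i) : OV Ω) : Ω) =
        ∑ i ∈ Finset.range n, (σ ^ i) (ζ ^ j) := by
      push_cast
      refine Finset.sum_congr rfl fun i _ => ?_
      rw [map_pow, iter_zeta hσ, ← pow_mul, ← pow_mul, mul_comm]
    have h2 : ‖((∑ i ∈ Finset.range n, (z ^ j) ^ (q ^ i) : OV Ω) : Ω)‖ < 1 :=
      lt_of_le_of_ne (norm_OV _) (by rw [h1]; exact hne j)
    rw [← res_eq_zero] at h2
    simpa [P, eval_finsetSum] using h2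
  have hP : P = 0 := by
    refine eq_zero_of_natDegree_lt_card_of_eval_eq_zero P
      (f := fun i : Fin (q ^ n - 1) => residue (OV Ω) z ^ (i : ℕ)) ?_ (fun i => hev i) ?_
    · intro i j hij
      exact Fin.ext (hprim.pow_inj i.2 j.2 hij)
    · rw [Fintype.card_fin]
      refine lt_of_le_of_lt (natDegree_sum_le_of_forall_le (n := q ^ (n - 1)) _ _ fun i hi => ?_)
        (pow_sub_one_gt h.one_lt hn1 (by omega))
      rw [natDegree_X_pow]
      exact Nat.pow_le_pow_right (by have := h.one_lt; omega)
        (by have := Finset.mem_range.1 hi; omega)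
  have hc : P.coeff 1 = 1 := by
    simp only [P, finsetSum_coeff, coeff_X_pow]
    rw [Finset.sum_eq_single 0]
    · simp
    · intro b _ hb
      rw [if_neg]
      have := Nat.one_lt_pow hb h.one_lt
      omega
    · simp [hn]
  rw [hP] at hc
  simp at hc

end Unramified

section NormSurj

set_option linter.unusedSectionVars false

open IsLocalRing Polynomial

theorem exists_unif (S : Type) [NontriviallyNormedField S] [IsUltrametricDist S] [ProperSpace S] :
    ∃ π : S, 0 < ‖π‖ ∧ ‖π‖ < 1 ∧ ∀ x : S, x ≠ 0 → ∃ k : ℤ, ‖x‖ = ‖π‖ ^ k := by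
  have hcomp : IsCompact (Metric.ball (0 : S) 1) :=
    Metric.isCompact_of_isClosed_isBounded (IsUltrametricDist.isClosed_ball _ _)
      Metric.isBounded_ball
  obtain ⟨π, hπ, hmax⟩ := hcomp.exists_isMaxOn ⟨0, by simp⟩ continuous_norm.continuousOn
  have hπ1 : ‖π‖ < 1 := by simpa using hπ
  have hmax' : ∀ x : S, ‖x‖ < 1 → ‖x‖ ≤ ‖π‖ := fun x hx => hmax (by simpa using hx)
  obtain ⟨x0, hx0, hx1⟩ := NormedField.exists_norm_lt_one S
  have hπ0 : 0 < ‖π‖ := hx0.trans_le (hmax' x0 hx1)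
  refine ⟨π, hπ0, hπ1, fun x hx => ?_⟩
  obtain ⟨k, hk1, hk2⟩ := exists_mem_Ioc_zpow (norm_pos_iff.2 hx) ((one_lt_inv₀ hπ0).2 hπ1)
  refine ⟨-(k + 1), ?_⟩
  rw [zpow_neg, ← inv_zpow]
  refine le_antisymm hk2 ?_
  by_contra! hlt
  have hpos : 0 < ‖π‖⁻¹ ^ (k + 1) := zpow_pos (inv_pos.2 hπ0) _
  have h1 : ‖x * π ^ (k + 1)‖ = ‖x‖ / ‖π‖⁻¹ ^ (k + 1) := by
    rw [norm_mul, norm_zpow, inv_zpow, div_inv_eq_mul]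
  have h2 := hmax' (x * π ^ (k + 1)) (by rw [h1, div_lt_one hpos]; exact hlt)
  rw [h1, div_le_iff₀ hpos, zpow_add_one₀ (inv_pos.2 hπ0).ne', mul_comm, mul_assoc,
    inv_mul_cancel₀ hπ0.ne', mul_one] at h2
  exact absurd hk1 (not_lt.2 h2)

variable {Ω : Type} [NormedField Ω] [IsUltrametricDist Ω]

theorem prod_approx (b : ℕ → Ω) (δ : ℝ) (hδ1 : δ ≤ 1) (hb : ∀ i, ‖b i‖ ≤ δ) (n : ℕ) :
    ‖∏ i ∈ Finset.range n, (1 + b i) - 1 - ∑ i ∈ Finset.range n, b i‖ ≤ δ * δ := by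
  have hδ0 : 0 ≤ δ := (norm_nonneg _).trans (hb 0)
  induction n with
  | zero => simpa using mul_nonneg hδ0 hδ0
  | succ n ih =>
    rw [Finset.prod_range_succ, Finset.sum_range_succ]
    have : (∏ i ∈ Finset.range n, (1 + b i)) * (1 + b n) - 1 - (∑ i ∈ Finset.range n, b i + b n)
      = (∏ i ∈ Finset.range n, (1 + b i) - 1 - ∑ i ∈ Finset.range n, b i) * (1 + b n)
        + b n * ∑ i ∈ Finset.range n, b i := by ring
    rw [this]
    refine (IsUltrametricDist.norm_add_le_max _ _).trans (max_le ?_ ?_)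
    · rw [norm_mul]
      have : ‖1 + b n‖ ≤ 1 := (IsUltrametricDist.norm_add_le_max _ _).trans
        (max_le (by simp) ((hb n).trans hδ1))
      calc _ ≤ δ * δ * 1 := mul_le_mul ih this (norm_nonneg _) (mul_nonneg hδ0 hδ0)
        _ = _ := mul_one _
    · rw [norm_mul]
      refine mul_le_mul (hb n) ?_ (norm_nonneg _) hδ0
      exact IsUltrametricDist.norm_sum_le_of_forall_le_of_nonneg hδ0 fun i _ => hb i

variable {S : Type} [NontriviallyNormedField S] [NormedAlgebra S Ω] [IsAlgClosed Ω]
  [Algebra.IsAlgebraic S Ω]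

theorem iter_mem {ζ : Ω} {σ : Ω ≃ₐ[S] Ω} {q : ℕ} (hσ : σ ζ = ζ ^ q) {x : Ω}
    (hx : x ∈ IntermediateField.adjoin S {ζ}) (i : ℕ) :
    (σ ^ i) x ∈ IntermediateField.adjoin S {ζ} := by
  induction i with
  | zero => simpa using hx
  | succ i ih => rw [pow_succ', AlgEquiv.mul_apply]; exact aut_mem hσ ih

theorem iter_norm {σ : Ω ≃ₐ[S] Ω} (hiso : ∀ x, ‖σ x‖ = ‖x‖) (x : Ω) (i : ℕ) :
    ‖(σ ^ i) x‖ = ‖x‖ := by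
  induction i with
  | zero => simp
  | succ i ih => rw [pow_succ', AlgEquiv.mul_apply, hiso, ih]

theorem iter_period {ζ : Ω} {σ : Ω ≃ₐ[S] Ω} {q n : ℕ} (hq : 1 < q)
    (hζ : IsPrimitiveRoot ζ (q ^ n - 1)) (hσ : σ ζ = ζ ^ q) {x : Ω}
    (hx : x ∈ IntermediateField.adjoin S {ζ}) : (σ ^ n) x = x := by
  obtain ⟨A, -, rfl⟩ := exists_poly rfl hx
  rw [iter_aeval hσ, pow_q_n hq hζ]

theorem norm_surj [ProperSpace S] {q n : ℕ} (h : IsRes Ω S q) (hn : 0 < n) {ζ : Ω}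
    (hζ : IsPrimitiveRoot ζ (q ^ n - 1)) (hdeg : (minpoly S ζ).natDegree = n)
    {σ : Ω ≃ₐ[S] Ω} (hσ : σ ζ = ζ ^ q) (hiso : ∀ x, ‖σ x‖ = ‖x‖) (u : S) (hu : ‖u‖ = 1) :
    ∃ v ∈ IntermediateField.adjoin S {ζ}, ‖v‖ = 1 ∧
      ∏ i ∈ Finset.range n, (σ ^ i) v = algebraMap S Ω u := by
  have hz1 := norm_zeta h hn hζ
  let M : IntermediateField S Ω := IntermediateField.adjoin S {ζ}
  have hζM : ζ ∈ M := IntermediateField.mem_adjoin_simple_self S ζ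
  have hIsInt : IsIntegral S ζ := Algebra.IsIntegral.isIntegral ζ
  let p : Submodule S Ω := Subalgebra.toSubmodule M.toSubalgebra
  have hfin : FiniteDimensional S M := IntermediateField.adjoin.finiteDimensional hIsInt
  have hfinp : FiniteDimensional S p := hfin
  have : ProperSpace p := FiniteDimensional.proper S p
  let Nm : Ω → Ω := fun v => ∏ i ∈ Finset.range n, (σ ^ i) v
  have hcσ : ∀ i, Continuous fun v => (σ ^ i) v := by
    intro i
    have : Isometry fun v => (σ ^ i) v :=
      AddMonoidHomClass.isometry_of_norm (σ ^ i) fun v => iter_norm hiso v i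
    exact this.continuous
  have hcN : Continuous Nm := continuous_finsetProd _ fun i _ => hcσ i
  have hNnorm : ∀ v, ‖v‖ = 1 → ‖Nm v‖ = 1 := by
    intro v hv
    simp only [Nm]
    rw [norm_prod]
    exact Finset.prod_eq_one fun i _ => by rw [iter_norm hiso, hv]
  -- a minimiser
  obtain ⟨v, hv, hmin⟩ := (isCompact_sphere (0 : p) 1).exists_isMinOn
    (f := fun v : p => ‖Nm v - algebraMap S Ω u‖)
    ⟨⟨1, M.one_mem⟩, by simp⟩ (by fun_prop)
  obtain ⟨v, hvM⟩ := v
  have hvM : v ∈ M := hvM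
  have hv1 : ‖v‖ = 1 := by simpa using hv
  have hmin' : ∀ w ∈ M, ‖w‖ = 1 → ‖Nm v - algebraMap S Ω u‖ ≤ ‖Nm w - algebraMap S Ω u‖ :=
    fun w hw hw1 => hmin (a := (⟨w, hw⟩ : p)) (by simpa using hw1)
  refine ⟨v, hvM, hv1, ?_⟩
  by_contra hne
  have hpos : 0 < ‖Nm v - algebraMap S Ω u‖ := norm_pos_iff.2 (sub_ne_zero.2 hne)
  have hlt : ‖Nm v - algebraMap S Ω u‖ < 1 := by
    have hgs : q ^ n - 1 = (∑ i ∈ Finset.range n, q ^ i) * (q - 1) := by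
      have h1 := Nat.geomSum_eq (m := q) h.one_lt n
      have h2 := Nat.sub_one_dvd_pow_sub_one q n
      rw [h1, Nat.div_mul_cancel h2]
    have hη := hζ.pow (by have := Nat.one_lt_pow hn.ne' h.one_lt; omega) hgs
    obtain ⟨j, hj⟩ := approx_unit h hη hu
    refine (hmin' (ζ ^ j) (pow_mem hζM j) (by rw [norm_pow, hz1, one_pow])).trans_lt ?_
    rw [norm_sub_rev]
    suffices hNz : Nm (ζ ^ j) = (ζ ^ ∑ i ∈ Finset.range n, q ^ i) ^ j by
      rw [hNz]; exact hj
    simp only [Nm]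
    rw [← pow_mul, mul_comm, pow_mul, ← Finset.prod_pow_eq_pow_sum]
    exact Finset.prod_congr rfl fun i _ => by rw [map_pow, iter_zeta hσ, ← pow_mul, ← pow_mul, mul_comm]
  -- norm in S
  have hNM : ∀ w ∈ M, Nm w ∈ M := fun w hw => prod_mem fun i _ => iter_mem hσ hw i
  obtain ⟨m, hm⟩ := fixed_mem h hn hζ hdeg hσ (hNM v hvM) (by
    simp only [Nm]
    rw [map_prod]
    have h1 := Finset.prod_range_succ (fun i => (σ ^ i) v) n
    rw [Finset.prod_range_succ', iter_period h.one_lt hζ hσ hvM, pow_zero,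
      AlgEquiv.one_apply] at h1
    have h2 := mul_right_cancel₀ (by rw [← norm_pos_iff, hv1]; exact one_pos) h1
    rw [← h2]
    exact Finset.prod_congr rfl fun i _ => by rw [pow_succ', AlgEquiv.mul_apply])
  -- trace in S
  obtain ⟨j, hj⟩ := trace_unit h hn hζ hσ
  obtain ⟨t, ht⟩ := fixed_mem h hn hζ hdeg hσ
    (sum_mem fun i (_ : i ∈ Finset.range n) => iter_mem hσ (pow_mem hζM j) i) (by
    rw [map_sum]
    have h1 := Finset.sum_range_succ (fun i => (σ ^ i) (ζ ^ j)) n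
    rw [Finset.sum_range_succ', iter_period h.one_lt hζ hσ (pow_mem hζM j), pow_zero,
      AlgEquiv.one_apply] at h1
    have h2 := add_right_cancel h1
    rw [← h2]
    exact Finset.sum_congr rfl fun i _ => by rw [pow_succ', AlgEquiv.mul_apply])
  have hm1 : ‖m‖ = 1 := by rw [← norm_algebraMap' Ω, hm]; exact hNnorm v hv1
  have ht1 : ‖t‖ = 1 := by rw [← norm_algebraMap' Ω, ht, hj]
  have hm0 : m ≠ 0 := by rw [← norm_pos_iff, hm1]; exact one_pos
  have ht0 : t ≠ 0 := by rw [← norm_pos_iff, ht1]; exact one_pos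
  set δ := ‖Nm v - algebraMap S Ω u‖ with hδ
  let a : S := u / m - 1
  have ha : ‖a‖ = δ := by
    have : a = (u - m) / m := by simp only [a]; field_simp
    rw [this, norm_div, hm1, div_one, hδ, ← hm, ← map_sub, norm_algebraMap', norm_sub_rev]
  let b : Ω := ζ ^ j * algebraMap S Ω (a / t)
  have hb : ‖b‖ = δ := by
    simp only [b]
    rw [norm_mul, norm_algebraMap', norm_div, ha, ht1, norm_pow, hz1]; simp
  have hbM : b ∈ M := mul_mem (pow_mem hζM j) (M.algebraMap_mem _)
  have hsb : ∑ i ∈ Finset.range n, (σ ^ i) b = algebraMap S Ω a := by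
    simp only [b, map_mul, AlgEquiv.commutes]
    rw [← Finset.sum_mul, ← ht, ← map_mul]
    congr 1
    field_simp
  have h1b : ‖1 + b‖ = 1 := by
    rw [add_comm, ← norm_one (α := Ω)]
    have := IsUltrametricDist.norm_add_eq_max_of_norm_ne_norm (x := b) (y := 1)
      (by rw [hb, norm_one]; exact hlt.ne)
    rw [this, hb, norm_one, max_eq_right hlt.le]
  have hle := hmin' (v * (1 + b)) (mul_mem hvM (add_mem M.one_mem hbM))
    (by rw [norm_mul, hv1, h1b, one_mul])
  have happ := prod_approx (fun i => (σ ^ i) b) δ hlt.le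
    (fun i => by rw [iter_norm hiso, hb]) n
  have hfin' : Nm (v * (1 + b)) - algebraMap S Ω u =
      Nm v * (∏ i ∈ Finset.range n, (1 + (σ ^ i) b) - 1 - ∑ i ∈ Finset.range n, (σ ^ i) b) := by
    have hu' : algebraMap S Ω u = Nm v * (1 + algebraMap S Ω a) := by
      rw [← hm, ← map_one (algebraMap S Ω), ← map_add, ← map_mul]
      congr 1
      simp only [a]; field_simp; ring
    rw [hsb, hu']
    simp only [Nm, map_mul, map_add, map_one, Finset.prod_mul_distrib]
    ring
  rw [hfin', norm_mul, hNnorm v hv1, one_mul] at hle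
  have := hle.trans happ
  nlinarith

end NormSurj

section EF

set_option linter.unusedSectionVars false

variable {Ω : Type} [NormedField Ω] [IsUltrametricDist Ω] [IsAlgClosed Ω]
  {K L : Type} [NontriviallyNormedField K] [NontriviallyNormedField L] [NormedAlgebra K Ω]
  [NormedAlgebra L Ω] [NormedAlgebra K L] [IsScalarTower K L Ω] [ProperSpace K] [ProperSpace L]
  [Algebra.IsAlgebraic K Ω] [FiniteDimensional K L]

theorem finrank_le_ef {q f r : ℕ} (hK : IsRes Ω K q) (hL : IsRes Ω L (q ^ f)) (hf : 0 < f)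
    (hr : 0 < r) (hiso : ∀ (τ : Ω ≃ₐ[K] Ω) x, ‖τ x‖ = ‖x‖) {η : L}
    (hη : IsPrimitiveRoot (algebraMap L Ω η) (q ^ f - 1)) {πK : K} {πL : L}
    (hπ : ‖πL‖ ^ r = ‖πK‖) (hπ0 : 0 < ‖πL‖)
    (hval : ∀ x : L, x ≠ 0 → ∃ k : ℤ, ‖x‖ = ‖πL‖ ^ k) : Module.finrank K L ≤ r * f := by
  let W := IntermediateField.adjoin K {η}
  have hW : Module.finrank K W = f := by
    rw [IntermediateField.adjoin.finrank (Algebra.IsIntegral.isIntegral η),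
      ← minpoly.algebraMap_eq (algebraMap L Ω).injective]
    exact (unramified hK hf hη hiso).1
  let T : (Fin r → W) →ₗ[K] L :=
    { toFun := fun y => ∑ j, (y j : L) * πL ^ (j : ℕ)
      map_add' := by intro x y; simp [add_mul, Finset.sum_add_distrib]
      map_smul' := by intro c x; simp [Finset.smul_sum] }
  have hT : ∀ y, T y = ∑ j, (y j : L) * πL ^ (j : ℕ) := fun _ => rfl
  have hdom : Module.finrank K (Fin r → W) = r * f := by
    rw [Module.finrank_pi_fintype]; simp [hW]
  have hcl : IsClosed (T.range : Set L) := Submodule.closed_of_finiteDimensional _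
  have hηm : η ∈ W := IntermediateField.mem_adjoin_simple_self K η
  have happ : ∀ x : L, x ≠ 0 → ∃ z ∈ T.range, ‖x - z‖ < ‖x‖ := by
    intro x hx
    obtain ⟨k, hk⟩ := hval x hx
    have hr' : (r : ℤ) ≠ 0 := by exact_mod_cast hr.ne'
    have hkj : 0 ≤ k % r := Int.emod_nonneg _ hr'
    have hkj2 : k % r < r := Int.emod_lt_of_pos _ (by exact_mod_cast hr)
    let j : ℕ := (k % r).toNat
    have hj : (j : ℤ) = k % r := Int.toNat_of_nonneg hkj
    have hjr : j < r := by omega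
    let s := k / r
    let c : L := algebraMap K L (πK ^ s) * πL ^ j
    have hc : ‖c‖ = ‖x‖ := by
      simp only [c]
      rw [norm_mul, norm_algebraMap', norm_zpow, ← hπ, norm_pow, hk, ← zpow_natCast,
        ← zpow_natCast, ← zpow_mul, ← zpow_add₀ hπ0.ne', hj]
      congr 1
      exact Int.mul_ediv_add_emod k r
    have hx0 : 0 < ‖x‖ := norm_pos_iff.2 hx
    have hc0 : c ≠ 0 := by rw [← norm_pos_iff, hc]; exact hx0
    obtain ⟨i, hi⟩ := approx_unit hL hη (u := x / c) (by rw [norm_div, hc, div_self hx0.ne'])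
    rw [← map_pow, ← map_sub, norm_algebraMap'] at hi
    refine ⟨c * η ^ i, ⟨Pi.single ⟨j, hjr⟩ ((πK ^ s) • ⟨η ^ i, pow_mem hηm i⟩), ?_⟩, ?_⟩
    · rw [hT, Finset.sum_eq_single ⟨j, hjr⟩]
      · rw [Pi.single_eq_same, IntermediateField.coe_smul, Algebra.smul_def]
        simp only [c]
        ring
      · intro b _ hb; simp [Pi.single_eq_of_ne hb]
      · simp
    · have : x - c * η ^ i = c * (x / c - η ^ i) := by field_simp
      rw [this, norm_mul, hc]
      exact mul_lt_of_lt_one_right hx0 hi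
  have htop : T.range = ⊤ := by
    rw [eq_top_iff]
    intro x _
    obtain ⟨y, hy, hxy⟩ := hcl.exists_infDist_eq_dist ⟨0, T.range.zero_mem⟩ x
    by_cases h0 : x - y = 0
    · rw [sub_eq_zero.1 h0]; exact hy
    · obtain ⟨z, hz, hlt⟩ := happ _ h0
      have := Metric.infDist_le_dist_of_mem (x := x) (T.range.add_mem hy hz)
      rw [hxy, dist_eq_norm, dist_eq_norm, ← sub_sub] at this
      exact absurd hlt (not_lt.2 this)
  rw [← finrank_top K L, ← htop, ← hdom]
  exact LinearMap.finrank_range_le T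

end EF

section Construct

set_option linter.unusedSectionVars false

/-- Multiplication action on a submodule of sequences. -/
def mulHom {K A Ω : Type} [Field K] [Ring A] [Field Ω] [Algebra K A] [Algebra K Ω]
    (V : Submodule K (ℕ → Ω)) (m : A →ₐ[K] (ℕ → Ω)) (hm : ∀ a, ∀ g ∈ V, m a * g ∈ V) :
    A →ₐ[K] Module.End K V :=
  AlgHom.ofLinearMap
    { toFun := fun a => (LinearMap.mulLeft K (m a)).restrict (hm a)
      map_add' := by intro a b; ext g i; simp [add_mul]; rfl
      map_smul' := by intro a b; ext g i; simp; rfl }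
    (by ext g i; simp) (by intro a b; ext g i; simp; rfl)

theorem mulHom_apply {K A Ω : Type} [Field K] [Ring A] [Field Ω] [Algebra K A] [Algebra K Ω]
    (V : Submodule K (ℕ → Ω)) (m : A →ₐ[K] (ℕ → Ω)) (hm : ∀ a, ∀ g ∈ V, m a * g ∈ V)
    (a : A) (g : V) (i : ℕ) : (mulHom V m hm a g : ℕ → Ω) i = m a i * (g : ℕ → Ω) i := rfl

theorem sum_ne_zero_of_dominant {Ω ι : Type} [NormedField Ω] [IsUltrametricDist Ω] [Fintype ι]
    (t : ι → Ω) (k0 : ι) (h0 : 0 < ‖t k0‖) (h : ∀ k, k ≠ k0 → ‖t k‖ < ‖t k0‖) :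
    ∑ k, t k ≠ 0 := by
  classical
  intro hs
  rw [← Finset.add_sum_erase _ _ (Finset.mem_univ k0)] at hs
  have h1 : ‖t k0‖ = ‖∑ k ∈ Finset.univ.erase k0, t k‖ := by
    rw [eq_neg_of_add_eq_zero_left hs, norm_neg]
  rcases (Finset.univ.erase k0).eq_empty_or_nonempty with he | he
  · rw [he, Finset.sum_empty, norm_zero] at h1
    exact h0.ne' h1
  · obtain ⟨i, hi, hle⟩ := IsUltrametricDist.exists_norm_finsetSum_le_of_nonempty he t
    have := h i (Finset.ne_of_mem_erase hi)
    linarith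

variable {Ω : Type} [NormedField Ω] [IsUltrametricDist Ω]
  {K L : Type} [NormedField K] [NormedField L] [NormedAlgebra K Ω]
  [NormedAlgebra L Ω] [NormedAlgebra K L] [IsScalarTower K L Ω]

/-- The space of semi-linear recurrent sequences. -/
def seqV (K : Type) [NormedField K] [NormedAlgebra K Ω] [NormedAlgebra K L] [IsScalarTower K L Ω]
    (M : IntermediateField L Ω) (σ : Ω ≃ₐ[L] Ω) (c : Ω) (f : ℕ) : Submodule K (ℕ → Ω) where
  carrier := {g | ∀ i, g i ∈ M ∧ g (i + f) = c * σ (g i)}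
  add_mem' := by
    intro a b ha hb i
    refine ⟨add_mem (ha i).1 (hb i).1, ?_⟩
    simp only [Pi.add_apply, (ha i).2, (hb i).2, map_add, mul_add]
  zero_mem' := by intro i; simp
  smul_mem' := by
    intro a g hg i
    have h1 : ∀ x : Ω, a • x = algebraMap L Ω (algebraMap K L a) * x := by
      intro x; rw [Algebra.smul_def, IsScalarTower.algebraMap_apply K L Ω]
    simp only [Pi.smul_apply, h1]
    refine ⟨mul_mem (M.algebraMap_mem _) (hg i).1, ?_⟩
    rw [(hg i).2, map_mul, AlgEquiv.commutes]
    ring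

theorem mem_seqV {M : IntermediateField L Ω} {σ : Ω ≃ₐ[L] Ω} {c : Ω} {f : ℕ} {g : ℕ → Ω} :
    g ∈ seqV K M σ c f ↔ ∀ i, g i ∈ M ∧ g (i + f) = c * σ (g i) := Iff.rfl

theorem seqV_add_mul {M : IntermediateField L Ω} {σ : Ω ≃ₐ[L] Ω} {c : Ω} {f : ℕ} {g : ℕ → Ω}
    (hg : g ∈ seqV K M σ c f) (k i : ℕ) :
    g (i + f * k) = (∏ j ∈ Finset.range k, (σ ^ j) c) * (σ ^ k) (g i) := by
  induction k with
  | zero => simp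
  | succ k ih =>
    rw [mul_add, mul_one, ← add_assoc, (hg _).2, ih, Finset.prod_range_succ', map_mul, map_prod,
      pow_zero, AlgEquiv.one_apply]
    simp only [pow_succ', AlgEquiv.mul_apply]
    ring

/-- The shift operator. -/
def shiftV (M : IntermediateField L Ω) (σ : Ω ≃ₐ[L] Ω) (c : Ω) (f : ℕ) :
    Module.End K (seqV K M σ c f) where
  toFun g := ⟨fun i => (g : ℕ → Ω) (i + 1), fun i => ⟨(g.2 _).1, by
    have := (g.2 (i + 1)).2
    rwa [add_right_comm] at this⟩⟩
  map_add' _ _ := rfl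
  map_smul' _ _ := rfl

theorem shiftV_pow (M : IntermediateField L Ω) (σ : Ω ≃ₐ[L] Ω) (c : Ω) (f k : ℕ)
    (g : seqV K M σ c f) (i : ℕ) :
    (((shiftV M σ c f) ^ k) g : ℕ → Ω) i = (g : ℕ → Ω) (i + k) := by
  induction k generalizing i with
  | zero => rfl
  | succ k ih =>
    rw [pow_succ', Module.End.mul_apply]
    refine (ih (i + 1)).trans ?_
    rw [add_assoc, add_comm 1 k]

theorem adequate_construct [FiniteDimensional K L] {f r : ℕ} (hf : 0 < f) (hr : 0 < r)
    (M : IntermediateField L Ω) (W : IntermediateField K Ω) (hWM : ∀ x ∈ W, x ∈ M)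
    [FiniteDimensional K W] [FiniteDimensional L M]
    (hW : Module.finrank K W = f * r) (hM : Module.finrank L M = r)
    (hL : Module.finrank K L ≤ f * r)
    (φ : Ω ≃ₐ[K] Ω) (σ : Ω ≃ₐ[L] Ω) (hφW : ∀ x ∈ W, φ x ∈ W) (hσM : ∀ x ∈ M, σ x ∈ M)
    (hσφ : ∀ x ∈ W, σ x = (φ ^ f) x) (hσr : ∀ x ∈ M, (σ ^ r) x = x)
    (hφiso : ∀ x, ‖φ x‖ = ‖x‖) (hσiso : ∀ x, ‖σ x‖ = ‖x‖)
    (hfix : ∀ x ∈ W, φ x = x → ∃ a : K, algebraMap K Ω a = x)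
    (hφ : ∀ i, 0 < i → i < f * r → ∃ a ∈ W, (φ ^ i) a ≠ a)
    (π : K) (hπ0 : 0 < ‖π‖) (hπ1 : ‖π‖ < 1)
    (hval : ∀ x ∈ W, x ≠ 0 → ∃ k : ℤ, ‖x‖ = ‖π‖ ^ k)
    (c : Ω) (hc : c ∈ M) (hcr : ∏ i ∈ Finset.range r, (σ ^ i) c = algebraMap K Ω π) :
    IsAdequate K L := by
  have hN : 0 < f * r := Nat.mul_pos hf hr
  have hφWi : ∀ (i : ℕ), ∀ x ∈ W, (φ ^ i) x ∈ W := by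
    intro i x hx
    induction i with
    | zero => simpa using hx
    | succ i ih => rw [pow_succ', AlgEquiv.mul_apply]; exact hφW _ ih
  have hφni : ∀ (i : ℕ) x, ‖(φ ^ i) x‖ = ‖x‖ := by
    intro i x
    induction i with
    | zero => simp
    | succ i ih => rw [pow_succ', AlgEquiv.mul_apply, hφiso, ih]
  have hσni : ∀ (i : ℕ) x, ‖(σ ^ i) x‖ = ‖x‖ := by
    intro i x
    induction i with
    | zero => simp
    | succ i ih => rw [pow_succ', AlgEquiv.mul_apply, hσiso, ih]
  have hσMi : ∀ (i : ℕ), ∀ x ∈ M, (σ ^ i) x ∈ M := by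
    intro i x hx
    induction i with
    | zero => simpa using hx
    | succ i ih => rw [pow_succ', AlgEquiv.mul_apply]; exact hσM _ ih
  let V := seqV K M σ c f
  -- the automorphism of W
  let ψ : W →ₐ[K] W := ((φ : Ω →ₐ[K] Ω).comp W.val).codRestrict W.toSubalgebra
    (fun x => hφW x x.2)
  let φW : W ≃ₐ[K] W := AlgEquiv.ofBijective ψ (AlgHom.bijective ψ)
  have hφW1 : ∀ x : W, ((φW x : W) : Ω) = φ x := fun _ => rfl
  have hφWk : ∀ (k : ℕ) (x : W), (((φW ^ k) x : W) : Ω) = (φ ^ k) x := by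
    intro k x
    induction k with
    | zero => rfl
    | succ k ih => rw [pow_succ', pow_succ', AlgEquiv.mul_apply, AlgEquiv.mul_apply, hφW1, ih]
  let mW : W →ₐ[K] (ℕ → Ω) := AlgHom.pi
    (fun i => ((φ ^ i : Ω ≃ₐ[K] Ω) : Ω →ₐ[K] Ω).comp W.val)
  have hmW : ∀ (w : W) i, mW w i = (φ ^ i) (w : Ω) := fun _ _ => rfl
  let mL : L →ₐ[K] (ℕ → Ω) := AlgHom.pi (fun i => IsScalarTower.toAlgHom K L Ω)
  have hmL : ∀ x i, mL x i = algebraMap L Ω x := fun _ _ => rfl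
  let ρ : W →ₐ[K] Module.End K V := mulHom V mW (by
    intro w g hg i
    simp only [Pi.mul_apply, hmW]
    refine ⟨mul_mem (hWM _ (hφWi i _ w.2)) (hg i).1, ?_⟩
    rw [map_mul, hσφ _ (hφWi i _ w.2), (hg i).2, add_comm i f, pow_add, AlgEquiv.mul_apply]
    ring)
  let l : L →ₐ[K] Module.End K V := mulHom V mL (by
    intro x g hg i
    simp only [Pi.mul_apply, hmL]
    refine ⟨mul_mem (M.algebraMap_mem _) (hg i).1, ?_⟩
    rw [map_mul, AlgEquiv.commutes, (hg i).2]
    ring)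
  let Q : Module.End K V := shiftV M σ c f
  have hρ : ∀ (w : W) (g : V) i, (ρ w g : ℕ → Ω) i = (φ ^ i) (w : Ω) * (g : ℕ → Ω) i :=
    fun _ _ _ => rfl
  have hl : ∀ (x : L) (g : V) i, (l x g : ℕ → Ω) i = algebraMap L Ω x * (g : ℕ → Ω) i :=
    fun _ _ _ => rfl
  have hQ1 : ∀ (g : V) i, (Q g : ℕ → Ω) i = (g : ℕ → Ω) (i + 1) := fun _ _ => rfl
  have hQk : ∀ (k : ℕ) (g : V) i, ((Q ^ k) g : ℕ → Ω) i = (g : ℕ → Ω) (i + k) :=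
    fun k g i => shiftV_pow M σ c f k g i
  -- finite dimension
  have hKM : FiniteDimensional K M := Module.Finite.trans L M
  have hfKM : Module.finrank K M = Module.finrank K L * r := by
    rw [← Module.finrank_mul_finrank K L M, hM]
  let E : V →ₗ[K] (Fin f → M) :=
    { toFun := fun g i => ⟨(g : ℕ → Ω) i, (g.2 i).1⟩
      map_add' := fun _ _ => rfl
      map_smul' := fun _ _ => rfl }
  have hE : Function.Injective E := by
    rw [← LinearMap.ker_eq_bot, LinearMap.ker_eq_bot']
    intro g hg
    have h0 : ∀ i : ℕ, i < f → (g : ℕ → Ω) i = 0 := by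
      intro i hi
      have := congrFun hg ⟨i, hi⟩
      exact congrArg Subtype.val this
    apply Subtype.ext
    funext i
    have := seqV_add_mul g.2 (i / f) (i % f)
    rw [Nat.mod_add_div, h0 _ (Nat.mod_lt _ hf), map_zero, mul_zero] at this
    exact this
  have hVfin : FiniteDimensional K V := Module.Finite.of_injective E hE
  have hVrank : Module.finrank K V ≤ Module.finrank K L * (f * r) := by
    refine (LinearMap.finrank_le_finrank_of_injective hE).trans ?_
    rw [Module.finrank_pi_fintype]
    simp only [hfKM, Finset.sum_const, Finset.card_univ, Fintype.card_fin, smul_eq_mul]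
    exact le_of_eq (by ring)
  have hVnt : Nontrivial V := by
    refine ⟨⟨⟨fun i => ∏ j ∈ Finset.range (i / f), (σ ^ j) c, fun i => ⟨?_, ?_⟩⟩, 0, ?_⟩⟩
    · exact prod_mem fun j _ => hσMi j _ hc
    · beta_reduce
      rw [Nat.add_div_right _ hf, Finset.prod_range_succ', map_prod, pow_zero,
        AlgEquiv.one_apply, mul_comm]
      simp only [pow_succ', AlgEquiv.mul_apply]
    · intro h
      have := congrFun (congrArg Subtype.val h) 0
      simp at this
  -- the real number theta
  let θ : ℝ := ‖π‖ ^ (((f * r : ℕ) : ℝ)⁻¹)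
  have hθN : θ ^ (f * r) = ‖π‖ := Real.rpow_inv_natCast_pow hπ0.le hN.ne'
  have hθ0 : 0 < θ := Real.rpow_pos_of_pos hπ0 _
  have hθ1 : θ < 1 := by
    by_contra! h1
    have := one_le_pow₀ h1 (n := f * r)
    rw [hθN] at this
    linarith
  have hcθ : ‖c‖ = θ ^ f := by
    have h1 := congrArg norm hcr
    rw [norm_prod, norm_algebraMap', Finset.prod_congr rfl (fun i _ => hσni i c),
      Finset.prod_const, Finset.card_range, ← hθN, pow_mul] at h1
    exact (pow_left_inj₀ (norm_nonneg _) (pow_nonneg hθ0.le _) hr.ne').1 h1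
  refine adequate_of_action (V := V) (f * r) hN hW φW ?_ ?_ π (norm_pos_iff.1 hπ0) ρ Q ?_ ?_ ?_ l
    ?_ ?_ hL hVrank
  · intro w hw
    obtain ⟨a, ha⟩ := hfix w w.2 (congrArg Subtype.val hw)
    exact ⟨a, Subtype.ext ha⟩
  · intro i hi hi'
    obtain ⟨a, ha, hne⟩ := hφ i hi hi'
    refine ⟨⟨a, ha⟩, fun h => hne ?_⟩
    rw [← hφWk i ⟨a, ha⟩, h]
  · intro w
    ext g i
    simp only [Module.End.mul_apply]
    rw [hQ1, hρ, hρ, hφW1, hQ1, pow_succ, AlgEquiv.mul_apply]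
  · ext g i
    rw [hQk, seqV_add_mul g.2, hcr, hσr _ (g.2 i).1, Module.algebraMap_end_apply,
      Submodule.coe_smul, Pi.smul_apply, Algebra.smul_def]
  · intro w g hwg
    by_contra! hcon
    obtain ⟨hw, hg⟩ := hcon
    have hsum : ∀ i : ℕ, ∑ k : Fin (f * r), (φ ^ i) (w k : Ω) * (g : ℕ → Ω) (i + k) = 0 := by
      intro i
      have h1 := congrFun (congrArg Subtype.val hwg) i
      rw [LinearMap.sum_apply] at h1
      have h2 : ((∑ k : Fin (f * r), (ρ (w k) * Q ^ (k : ℕ)) g : V) : ℕ → Ω) i =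
          ∑ k : Fin (f * r), (φ ^ i) (w k : Ω) * (g : ℕ → Ω) (i + k) := by
        rw [Submodule.coe_sum, Finset.sum_apply]
        exact Finset.sum_congr rfl fun k _ => by rw [Module.End.mul_apply, hρ, hQk]
      rw [← h2]
      exact h1
    let h : ℕ → ℝ := fun i => ‖(g : ℕ → Ω) i‖ / θ ^ i
    have hgh : ∀ i, ‖(g : ℕ → Ω) i‖ = h i * θ ^ i := fun i =>
      (div_mul_cancel₀ _ (pow_pos hθ0 i).ne').symm
    have hper : ∀ i k, h (i + f * k) = h i := by
      intro i k
      simp only [h]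
      rw [seqV_add_mul g.2, norm_mul, norm_prod, Finset.prod_congr rfl (fun i _ => hσni i c),
        Finset.prod_const, Finset.card_range, hσni, hcθ, ← pow_mul, pow_add]
      have := (pow_pos hθ0 i).ne'
      have := (pow_pos hθ0 (f * k)).ne'
      field_simp
    obtain ⟨i0, -, hi0⟩ := Finset.exists_max_image (Finset.range f) h ⟨0, Finset.mem_range.2 hf⟩
    have hmax : ∀ i, h i ≤ h i0 := by
      intro i
      rw [← Nat.mod_add_div i f, hper]
      exact hi0 _ (Finset.mem_range.2 (Nat.mod_lt _ hf))
    have hpos : 0 < h i0 := by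
      by_contra! hle
      apply hg
      apply Subtype.ext
      funext i
      have h1 : ‖(g : ℕ → Ω) i‖ ≤ 0 := by
        rw [hgh]
        exact mul_nonpos_of_nonpos_of_nonneg ((hmax i).trans hle) (pow_pos hθ0 i).le
      exact norm_le_zero_iff.1 h1
    have : Nonempty (Fin (f * r)) := ⟨⟨0, hN⟩⟩
    obtain ⟨k0, -, hk0⟩ := Finset.exists_max_image (Finset.univ : Finset (Fin (f * r)))
      (fun k => ‖(w k : Ω)‖ * θ ^ (k : ℕ)) Finset.univ_nonempty
    have hw0 : (w k0 : Ω) ≠ 0 := by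
      intro hz
      apply hw
      funext k
      have h1 := hk0 k (Finset.mem_univ _)
      simp only [hz, norm_zero, zero_mul] at h1
      have h2 : ‖(w k : Ω)‖ ≤ 0 := nonpos_of_mul_nonpos_left h1 (pow_pos hθ0 _)
      exact Subtype.ext (norm_le_zero_iff.1 h2)
    have hstrict : ∀ k, k ≠ k0 →
        ‖(w k : Ω)‖ * θ ^ (k : ℕ) < ‖(w k0 : Ω)‖ * θ ^ (k0 : ℕ) := by
      intro k hk
      refine lt_of_le_of_ne (hk0 k (Finset.mem_univ _)) fun heq => hk ?_
      have hwk : (w k : Ω) ≠ 0 := by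
        intro hz
        rw [hz, norm_zero, zero_mul] at heq
        exact (mul_pos (norm_pos_iff.2 hw0) (pow_pos hθ0 _)).ne heq
      obtain ⟨a, ha⟩ := hval _ (w k).2 hwk
      obtain ⟨b, hb⟩ := hval _ (w k0).2 hw0
      rw [ha, hb, ← hθN, ← zpow_natCast, ← zpow_natCast, ← zpow_natCast, ← zpow_mul, ← zpow_mul,
        ← zpow_add₀ hθ0.ne', ← zpow_add₀ hθ0.ne'] at heq
      have hab := zpow_right_injective₀ hθ0 hθ1.ne heq
      have h1 := congrArg (fun z : ℤ => z % ((f * r : ℕ) : ℤ)) hab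
      simp only [Int.mul_add_emod_self_left] at h1
      rw [Int.emod_eq_of_lt (by omega) (by exact_mod_cast k.2),
        Int.emod_eq_of_lt (by omega) (by exact_mod_cast k0.2)] at h1
      exact Fin.ext (by exact_mod_cast h1)
    have hIk : (k0 : ℕ) ≤ i0 + f * k0 := by nlinarith
    obtain ⟨m, hm⟩ := Nat.exists_eq_add_of_le hIk
    have hhm : h (m + k0) = h i0 := by rw [add_comm m, ← hm, hper]
    have hterm : ∀ k : Fin (f * r), ‖(φ ^ m) (w k : Ω) * (g : ℕ → Ω) (m + k)‖ =
        (‖(w k : Ω)‖ * θ ^ (k : ℕ)) * (h (m + k) * θ ^ m) := by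
      intro k
      rw [norm_mul, hφni, hgh, pow_add]
      ring
    refine sum_ne_zero_of_dominant _ k0 ?_ ?_ (hsum m)
    · rw [hterm, hhm]
      exact mul_pos (mul_pos (norm_pos_iff.2 hw0) (pow_pos hθ0 _)) (mul_pos hpos (pow_pos hθ0 _))
    · intro k hk
      rw [hterm, hterm, hhm]
      refine mul_lt_mul_of_lt_of_le_of_nonneg_of_pos (hstrict k hk) ?_ ?_ ?_
      · exact mul_le_mul_of_nonneg_right (hmax _) (pow_pos hθ0 _).le
      · exact mul_nonneg (norm_nonneg _) (pow_pos hθ0 _).le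
      · exact mul_pos hpos (pow_pos hθ0 _)
  · intro x w
    ext g i
    simp only [Module.End.mul_apply]
    rw [hl, hρ, hρ, hl]
    ring
  · intro x
    ext g i
    simp only [Module.End.mul_apply]
    rw [hl, hQ1, hQ1, hl]

end Construct

section Normed

set_option linter.unusedSectionVars false

variable {Ω : Type} [NormedField Ω] [IsUltrametricDist Ω] [IsAlgClosed Ω]
  {K L : Type} [NontriviallyNormedField K] [NontriviallyNormedField L] [NormedAlgebra K Ω]
  [NormedAlgebra L Ω] [NormedAlgebra K L] [IsScalarTower K L Ω] [ProperSpace K] [ProperSpace L]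
  [Algebra.IsAlgebraic K Ω] [Algebra.IsAlgebraic L Ω] [FiniteDimensional K L]
  [IsUltrametricDist K] [IsUltrametricDist L]

theorem adequate_normed (hiso : ∀ (τ : Ω ≃ₐ[K] Ω) x, ‖τ x‖ = ‖x‖) : IsAdequate K L := by
  have hisoL : ∀ (τ : Ω ≃ₐ[L] Ω) x, ‖τ x‖ = ‖x‖ := fun τ x => hiso (τ.restrictScalars K) x
  have hKr := isRes_card (Ω := Ω) K
  have hLr := isRes_card (Ω := Ω) L
  obtain ⟨f, hf, hcard⟩ := card_kS_tower (Ω := Ω) K L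
  obtain ⟨η, hη⟩ := exists_primitive (Ω := Ω) (S := L)
  rw [hcard] at hLr hη
  set q := Nat.card (kS Ω K) with hq
  obtain ⟨πK, hK0, hK1, hKval⟩ := exists_unif K
  obtain ⟨πL, hL0, hL1, hLval⟩ := exists_unif L
  obtain ⟨k, hk⟩ := hLval (algebraMap K L πK) (by
    rw [← norm_pos_iff, norm_algebraMap']; exact hK0)
  rw [norm_algebraMap'] at hk
  have hkpos : 0 < k := by
    by_contra! hle
    rw [hk] at hK1
    exact absurd hK1 (not_lt.2 (one_le_zpow_of_nonpos₀ hL0 hL1.le hle))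
  obtain ⟨r, rfl⟩ := Int.eq_ofNat_of_zero_le hkpos.le
  rw [zpow_natCast] at hk
  have hr : 0 < r := by exact_mod_cast hkpos
  have hN : 0 < f * r := Nat.mul_pos hf hr
  have hfin := finrank_le_ef hKr hLr hf hr hiso hη hk.symm hL0 hLval
  have hne : NeZero ((q ^ (f * r) - 1 : ℕ) : Ω) := by
    constructor
    intro h0
    have h1 := norm_q_pow hKr hN
    have h2 : q ^ (f * r) = (q ^ (f * r) - 1) + 1 := by
      have := Nat.one_lt_pow hN.ne' hKr.one_lt
      omega
    rw [h2, Nat.cast_add, h0] at h1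
    norm_num at h1
  obtain ⟨ζ, hζ⟩ := HasEnoughRootsOfUnity.exists_primitiveRoot Ω (q ^ (f * r) - 1)
  have hζL : IsPrimitiveRoot ζ ((q ^ f) ^ r - 1) := by rw [← pow_mul]; exact hζ
  obtain ⟨hdK, φ, hφ⟩ := unramified hKr hN hζ hiso
  obtain ⟨hdL, σ, hσ⟩ := unramified hLr hr hζL hisoL
  let W := IntermediateField.adjoin K {ζ}
  let M := IntermediateField.adjoin L {ζ}
  have hintK : IsIntegral K ζ := Algebra.IsIntegral.isIntegral ζ
  have hintL : IsIntegral L ζ := Algebra.IsIntegral.isIntegral ζ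
  have hfW : FiniteDimensional K W := IntermediateField.adjoin.finiteDimensional hintK
  have hfM : FiniteDimensional L M := IntermediateField.adjoin.finiteDimensional hintL
  have hζW : ζ ∈ W := IntermediateField.mem_adjoin_simple_self K ζ
  have hζM : ζ ∈ M := IntermediateField.mem_adjoin_simple_self L ζ
  have hWM : ∀ x ∈ W, x ∈ M := by
    have : W ≤ M.restrictScalars K := IntermediateField.adjoin_simple_le_iff.2 hζM
    exact fun x hx => this hx
  have hL0' : πL ≠ 0 := norm_pos_iff.1 hL0
  obtain ⟨v, hvM, hv1, hv⟩ := norm_surj hLr hr hζL hdL hσ (hisoL σ)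
    (algebraMap K L πK / πL ^ r) (by
      rw [norm_div, norm_algebraMap', norm_pow, hk, div_self (pow_pos hL0 r).ne'])
  refine adequate_construct hf hr M W hWM ?_ ?_ (by rw [mul_comm]; exact hfin) φ σ
    (fun x hx => aut_mem hφ hx) (fun x hx => aut_mem hσ hx) ?_
    (fun x hx => iter_period hLr.one_lt hζL hσ hx) (hiso φ) (hisoL σ)
    (fun x hx hfx => fixed_mem hKr hN hζ hdK hφ hx hfx) ?_ πK hK0 hK1 ?_
    (algebraMap L Ω πL * v) (mul_mem (M.algebraMap_mem _) hvM) ?_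
  · rw [IntermediateField.adjoin.finrank hintK, hdK]
  · rw [IntermediateField.adjoin.finrank hintL, hdL]
  · intro x hx
    obtain ⟨A, -, rfl⟩ := exists_poly rfl hx
    rw [iter_aeval hφ, ← hσ]
    exact (Polynomial.aeval_algHom_apply (σ.restrictScalars K) ζ A).symm
  · intro i hi hi'
    refine ⟨ζ, hζW, fun h => ?_⟩
    rw [iter_zeta hφ] at h
    have := @conjq_injective _ _ _ _ _ hKr.one_lt hζ ⟨i, hi'⟩ ⟨0, hN⟩ (by simpa using h)
    have := congrArg Fin.val this
    simp only at this
    omega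
  · intro x hx hx0
    obtain ⟨a, ha⟩ := norm_value hKr hN hζ hdK hx
    obtain ⟨k, hk⟩ := hKval a (by rw [← norm_pos_iff, ha]; exact norm_pos_iff.2 hx0)
    exact ⟨k, by rw [← ha, hk]⟩
  · simp only [map_mul, AlgEquiv.commutes]
    rw [Finset.prod_mul_distrib, hv, Finset.prod_const, Finset.card_range, ← map_pow, ← map_mul,
      mul_div_cancel₀ _ (pow_ne_zero r hL0'), ← IsScalarTower.algebraMap_apply]

end Normed

section Base

theorem adequate_of_base (F K L : Type) [NontriviallyNormedField F] [IsUltrametricDist F]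
    [ProperSpace F] [Field K] [Algebra F K] [FiniteDimensional F K] [Field L] [Algebra K L]
    [FiniteDimensional K L] : IsAdequate K L := by
  let : Algebra F L := ((algebraMap K L).comp (algebraMap F K)).toAlgebra
  have : IsScalarTower F K L := IsScalarTower.of_algebraMap_eq fun _ => rfl
  have : FiniteDimensional F L := Module.Finite.trans K L
  let Ω := AlgebraicClosure L
  have : IsScalarTower F L Ω := inferInstance
  have : IsScalarTower K L Ω := inferInstance
  have : IsScalarTower F K Ω := IsScalarTower.of_algebraMap_eq fun x => by
    rw [IsScalarTower.algebraMap_apply F L Ω, IsScalarTower.algebraMap_apply K L Ω,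
      IsScalarTower.algebraMap_apply F K L]
  have : Algebra.IsAlgebraic L Ω := inferInstance
  have : Algebra.IsAlgebraic F Ω := Algebra.IsAlgebraic.trans F L Ω
  have : Algebra.IsAlgebraic K Ω := Algebra.IsAlgebraic.trans K L Ω
  let iK : NontriviallyNormedField K := spectralNorm.nontriviallyNormedField F K
  let iL : NontriviallyNormedField L := spectralNorm.nontriviallyNormedField F L
  let iΩ : NormedField Ω := spectralNorm.normedField F Ω
  let : NormedAlgebra F K := spectralNorm.normedAlgebra F K
  let : NormedAlgebra F L := spectralNorm.normedAlgebra F L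
  let : NormedAlgebra K L := spectralNorm.normedAlgebra' F K L
  let : NormedAlgebra K Ω := spectralNorm.normedAlgebra' F K Ω
  let : NormedAlgebra L Ω := spectralNorm.normedAlgebra' F L Ω
  have : ProperSpace K := FiniteDimensional.proper F K
  have : ProperSpace L := FiniteDimensional.proper F L
  have : IsUltrametricDist K := IsUltrametricDist.isUltrametricDist_of_isNonarchimedean_norm
    (isNonarchimedean_spectralNorm (K := F) (L := K))
  have : IsUltrametricDist L := IsUltrametricDist.isUltrametricDist_of_isNonarchimedean_norm
    (isNonarchimedean_spectralNorm (K := F) (L := L))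
  have : IsUltrametricDist Ω := IsUltrametricDist.isUltrametricDist_of_isNonarchimedean_norm
    (isNonarchimedean_spectralNorm (K := F) (L := Ω))
  refine adequate_normed (Ω := Ω) (K := K) (L := L) fun τ x => ?_
  exact (spectralNorm_eq_of_equiv (K := F) (τ.restrictScalars F) x).symm

end Base

theorem adequate_of_laurent (p : ℕ) [Fact p.Prime] (K L : Type) [Field K]
    [Algebra (LaurentSeries (ZMod p)) K] [FiniteDimensional (LaurentSeries (ZMod p)) K]
    [Field L] [Algebra K L] [FiniteDimensional K L] : IsAdequate K L := by
  have he : (2 : NNReal) ≠ 0 := by norm_num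
  have he1 : (1 : NNReal) < 2 := by norm_num
  let r : (Valued.v (R := LaurentSeries (ZMod p))).RankOne :=
    { hom' := (WithZeroMulInt.toNNReal he).comp MonoidWithZeroHom.ValueGroup₀.embedding
      strictMono' := (WithZeroMulInt.toNNReal_strictMono he1).comp
        MonoidWithZeroHom.ValueGroup₀.embedding_strictMono
      exists_val_nontrivial := by
        obtain ⟨x, hx⟩ := LaurentSeries.valuation_surjective (ZMod p)
          (WithZero.exp (1 : ℤ))
        refine ⟨x, ?_, ?_⟩ <;> rw [hx] <;> simp [← WithZero.exp_zero]}
  let nF : NontriviallyNormedField (LaurentSeries (ZMod p)) :=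
    Valued.toNontriviallyNormedField (LaurentSeries (ZMod p)) (WithZero (Multiplicative ℤ))
  let O := Valued.integer (LaurentSeries (ZMod p))
  have hmem : ∀ f : PowerSeries (ZMod p), (f : LaurentSeries (ZMod p)) ∈ O := fun f =>
    (LaurentSeries.val_le_one_iff_eq_coe (ZMod p) _).2 ⟨f, rfl⟩
  let φ : PowerSeries (ZMod p) →+* O :=
    (HahnSeries.ofPowerSeries ℤ (ZMod p)).codRestrict O hmem
  have hφ : Function.Bijective φ := by
    constructor
    · intro a b h
      exact HahnSeries.ofPowerSeries_injective (congrArg Subtype.val h)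
    · rintro ⟨x, hx⟩
      obtain ⟨f, hf⟩ := (LaurentSeries.val_le_one_iff_eq_coe (ZMod p) x).1 hx
      exact ⟨f, Subtype.ext hf⟩
  let ψ := RingEquiv.ofBijective φ hφ
  have hdvr : IsDiscreteValuationRing O := IsDiscreteValuationRing.RingEquivClass.isDiscreteValuationRing ψ
  have hfin : Finite (IsLocalRing.ResidueField O) := by
    let g : ZMod p → IsLocalRing.ResidueField O := fun a =>
      IsLocalRing.residue O (ψ (PowerSeries.C a))
    refine Finite.of_surjective g ?_
    intro y
    obtain ⟨x, rfl⟩ := IsLocalRing.residue_surjective y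
    obtain ⟨f, rfl⟩ := ψ.surjective x
    refine ⟨PowerSeries.constantCoeff f, ?_⟩
    change IsLocalRing.residue O _ = _
    rw [← sub_eq_zero, ← map_sub, ← map_sub, IsLocalRing.residue_eq_zero_iff,
      IsLocalRing.mem_maximalIdeal, mem_nonunits_iff, MulEquiv.isUnit_map,
      PowerSeries.isUnit_iff_constantCoeff]
    simp
  have hp : ProperSpace (LaurentSeries (ZMod p)) :=
    Valued.integer.properSpace_iff_completeSpace_and_isDiscreteValuationRing_integer_and_finite_residueField.2
      ⟨inferInstance, hdvr, hfin⟩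
  have hu : IsUltrametricDist (LaurentSeries (ZMod p)) :=
    Valued.instIsUltrametricDist (LaurentSeries (ZMod p)) (WithZero (Multiplicative ℤ))
  exact adequate_of_base (LaurentSeries (ZMod p)) K L

theorem adequate_of_bij (K L : Type) [Field K] [Field L] [Algebra K L]
    (h : Function.Bijective (algebraMap K L)) : IsAdequate K L := by
  let e : K ≃ₐ[K] L := AlgEquiv.ofBijective (Algebra.ofId K L) h
  refine ⟨K, inferInstance, inferInstance, inferInstance, ?_, e.symm.toAlgHom, ?_⟩
  · exact Subsingleton.elim _ _
  · rw [← e.toLinearEquiv.finrank_eq]; simp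

theorem quat_center (x : Quaternion ℝ) (hx : ∀ b : Quaternion ℝ, b * x = x * b) :
    algebraMap ℝ (Quaternion ℝ) x.re = x := by
  have hK : ∀ a b c d : ℝ, a * x.imK + b * x.imJ - c * x.imI + d * x.re =
      x.re * d + x.imI * c - x.imJ * b + x.imK * a := fun a b c d =>
    (Quaternion.imK_mul (R := ℝ) ⟨a, b, c, d⟩ x).symm.trans
      ((congrArg QuaternionAlgebra.imK (hx ⟨a, b, c, d⟩)).trans
        (Quaternion.imK_mul (R := ℝ) x ⟨a, b, c, d⟩))
  have hJ : ∀ a b c d : ℝ, a * x.imJ - b * x.imK + c * x.re + d * x.imI =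
      x.re * c - x.imI * d + x.imJ * a + x.imK * b := fun a b c d =>
    (Quaternion.imJ_mul (R := ℝ) ⟨a, b, c, d⟩ x).symm.trans
      ((congrArg QuaternionAlgebra.imJ (hx ⟨a, b, c, d⟩)).trans
        (Quaternion.imJ_mul (R := ℝ) x ⟨a, b, c, d⟩))
  have a1 := hK 0 1 0 0
  have a2 := hK 0 0 1 0
  have a3 := hJ 0 1 0 0
  refine Quaternion.ext _ _ ?_ ?_ ?_ ?_
  · rfl
  · change 0 = x.imI
    linarith
  · change 0 = x.imJ
    linarith
  · change 0 = x.imK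
    linarith

theorem adequate_of_real (K L : Type) [Field K] [Field L] [Algebra K L]
    [FiniteDimensional K L] (e : K ≃+* ℝ) : IsAdequate K L := by
  let aL : Algebra ℝ L := ((algebraMap K L).comp e.symm.toRingHom).toAlgebra
  let aK : Algebra K ℝ := e.toRingHom.toAlgebra
  have hmapL : ∀ x : K, algebraMap ℝ L (e x) = algebraMap K L x := fun x => by
    change algebraMap K L (e.symm (e x)) = _
    simp
  have hst : IsScalarTower K ℝ L := IsScalarTower.of_algebraMap_eq fun x => (hmapL x).symm
  have hfin : FiniteDimensional ℝ L := Module.Finite.of_restrictScalars_finite K ℝ L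
  have hK1 : Module.finrank K ℝ = 1 := by
    let e' : K ≃ₐ[K] ℝ := AlgEquiv.ofBijective (Algebra.ofId K ℝ) e.bijective
    rw [← e'.toLinearEquiv.finrank_eq]; simp
  rcases Real.nonempty_algEquiv_or L with ⟨⟨f⟩⟩ | ⟨⟨f⟩⟩
  · apply adequate_of_bij
    refine ⟨(algebraMap K L).injective, fun y => ⟨e.symm (f y), ?_⟩⟩
    change algebraMap ℝ L (f y) = y
    apply f.injective
    rw [f.commutes]; rfl
  · have hst2 : IsScalarTower K ℝ (Quaternion ℝ) :=
      IsScalarTower.of_algebraMap_eq fun x => rfl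
    have hKf : FiniteDimensional K ℝ := Module.finite_of_finrank_eq_succ hK1
    refine ⟨Quaternion ℝ, inferInstance, inferInstance, ?_, ?_, ?_⟩
    · exact Module.Finite.trans ℝ _
    · rw [eq_bot_iff]
      intro x hx
      rw [Subalgebra.mem_center_iff] at hx
      rw [Algebra.mem_bot]
      refine ⟨e.symm x.re, ?_⟩
      change algebraMap ℝ (Quaternion ℝ) (e (e.symm x.re)) = x
      rw [e.apply_symm_apply]
      exact quat_center x hx
    · refine ⟨((Quaternion.ofComplex.comp f.toAlgHom).restrictScalars K), ?_⟩
      have hL : Module.finrank ℝ L = 2 := by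
        rw [f.toLinearEquiv.finrank_eq]; exact Complex.finrank_real_complex
      rw [← Module.finrank_mul_finrank K ℝ L, ← Module.finrank_mul_finrank K ℝ (Quaternion ℝ),
        hK1, hL, Quaternion.finrank_eq_four]

/-- If `K` is a local field, then every finite Galois field extension `L/K` is
`K`-adequate. -/
theorem adequate_of_localField (K : Type) [Field K] (hK : IsLocalField K)
    (L : Type) [Field L] [Algebra K L] [FiniteDimensional K L] [IsGalois K L] :
    IsAdequate K L := by
  rcases hK with ⟨⟨e⟩⟩ | ⟨⟨e⟩⟩ | ⟨p, hp, hA, hf⟩ | ⟨p, hp, hA, hf⟩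
  · exact adequate_of_real K L e
  · have : IsAlgClosed K := IsAlgClosed.of_ringEquiv ℂ K e.symm
    exact adequate_of_bij K L IsAlgClosed.algebraMap_bijective_of_isIntegral
  · have : Fact p.Prime := ⟨hp⟩
    exact adequate_of_base ℚ_[p] K L
  · have : Fact p.Prime := ⟨hp⟩
    exact adequate_of_laurent p K L

end
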